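/- Write T_k = k(k+1)/2. For m ≥ 1 and n = T_m, let p(m) denote the probability that a partition λ of n chosen according to the Plancherel measure admits a decomposition λ = λ1 +_H λ2 +_H λ3 +_H λ4, where λ1 ⊢ T_{⌊(m+1)/2⌋} is dominance-comparable to ρ_{⌊(m+1)/2⌋}, λ2 ⊢ T_{⌊m/2⌋} and λ3 ⊢ T_{⌊m/2⌋} are each dominance-comparable to ρ_{⌊m/2⌋}, and λ4 ⊢ T_{⌊(m−1)/2⌋} is dominance-comparable to ρ_{⌊(m−1)/2⌋}. Then p(m) → 1 as m → ∞. -/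

import Mathlib

/-- A partition, encoded by its weakly decreasing (0-indexed) sequence of parts,
eventually zero.  Horizontal sum `+_H` is pointwise addition of part functions. -/
def IsPtnFun (f : ℕ → ℕ) : Prop :=
  Antitone f ∧ ∃ N, ∀ i, N ≤ i → f i = 0

/-- The size (number of boxes) of a partition: the sum of its parts. -/
noncomputable def psize (f : ℕ → ℕ) : ℕ := ∑' i, f i

/-- The staircase partition `ρ_m = (m, m-1, …, 1)`. -/
def rho (m : ℕ) : ℕ → ℕ := fun i => m - i

/-- The triangular number `T_k = k(k+1)/2`. -/
def tri (k : ℕ) : ℕ := k * (k + 1) / 2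

/-- `f` dominates `g`: every partial sum of parts of `f` is at least that of `g`. -/
def Dominates (f g : ℕ → ℕ) : Prop :=
  ∀ r : ℕ, ∑ i ∈ Finset.range r, g i ≤ ∑ i ∈ Finset.range r, f i

/-- Dominance-comparability. -/
def DomComparable (f g : ℕ → ℕ) : Prop := Dominates f g ∨ Dominates g f

/-- `λ ⊢ T_m` admits a decomposition `λ = λ₁ +_H λ₂ +_H λ₃ +_H λ₄` where
`λ₁ ⊢ T_{⌊(m+1)/2⌋}`, `λ₂, λ₃ ⊢ T_{⌊m/2⌋}`, `λ₄ ⊢ T_{⌊(m-1)/2⌋}`, each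
dominance-comparable to the staircase of the corresponding size. -/
def GoodDecomp (m : ℕ) (f : ℕ → ℕ) : Prop :=
  ∃ g₁ g₂ g₃ g₄ : ℕ → ℕ,
    IsPtnFun g₁ ∧ IsPtnFun g₂ ∧ IsPtnFun g₃ ∧ IsPtnFun g₄ ∧
    psize g₁ = tri ((m + 1) / 2) ∧ psize g₂ = tri (m / 2) ∧
    psize g₃ = tri (m / 2) ∧ psize g₄ = tri ((m - 1) / 2) ∧
    DomComparable g₁ (rho ((m + 1) / 2)) ∧ DomComparable g₂ (rho (m / 2)) ∧
    DomComparable g₃ (rho (m / 2)) ∧ DomComparable g₄ (rho ((m - 1) / 2)) ∧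
    f = g₁ + g₂ + g₃ + g₄

/-- `T` is a standard Young tableau of shape `f`: it labels the cells
`{(i,j) : j < f i}` bijectively by `1, …, |f|`, is zero off the diagram, and
increases along rows and down columns. -/
def IsSYT (f : ℕ → ℕ) (T : ℕ × ℕ → ℕ) : Prop :=
  (∀ p : ℕ × ℕ, ¬ p.2 < f p.1 → T p = 0) ∧
  (∀ i j, j + 1 < f i → T (i, j) < T (i, j + 1)) ∧
  (∀ i j, j < f (i + 1) → T (i, j) < T (i + 1, j)) ∧
  Set.BijOn T {p : ℕ × ℕ | p.2 < f p.1} (Set.Icc 1 (psize f))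

/-- `f^λ`, the number of standard Young tableaux of shape `λ`. -/
noncomputable def sytCount (f : ℕ → ℕ) : ℕ := Nat.card {T : ℕ × ℕ → ℕ // IsSYT f T}

namespace Plancherel

/-! ### Partitions, corners and edges of Young's graph -/

section

open Finset

/-- `f` is a partition of `n`, with its support bound and its size made explicit. -/
structure IsPart (n : ℕ) (f : ℕ → ℕ) : Prop where
  anti : Antitone f
  zero : ∀ i, n ≤ i → f i = 0
  sum : ∑ i ∈ range n, f i = n

lemma sum_range_eq_of_zero {f : ℕ → ℕ} {N M : ℕ} (hz : ∀ i, N ≤ i → f i = 0) (h : N ≤ M) :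
    ∑ i ∈ range M, f i = ∑ i ∈ range N, f i := by
  symm
  apply sum_subset (by simpa using h)
  intro i _ hi
  exact hz i (by simpa using hi)

lemma IsPart.sum_range {n N : ℕ} {f : ℕ → ℕ} (hf : IsPart n f) (h : n ≤ N) :
    ∑ i ∈ range N, f i = n := by
  rw [sum_range_eq_of_zero hf.zero h, hf.sum]

lemma psize_eq_sum {f : ℕ → ℕ} {N : ℕ} (hz : ∀ i, N ≤ i → f i = 0) :
    psize f = ∑ i ∈ range N, f i :=
  tsum_eq_sum (fun i hi => hz i (by simpa using hi))

lemma IsPart.of {n N : ℕ} {f : ℕ → ℕ} (ha : Antitone f) (hz : ∀ i, N ≤ i → f i = 0)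
    (hs : ∑ i ∈ range N, f i = n) : IsPart n f := by
  have hz' : ∀ i, n ≤ i → f i = 0 := by
    intro i hi
    by_contra hne
    have hiN : i < N := by
      by_contra hh
      exact hne (hz i (not_lt.1 hh))
    have h1 : ∑ j ∈ range (i + 1), f j ≤ n := by
      rw [← hs]
      exact sum_le_sum_of_subset (by simpa using hiN)
    have h2 : ∑ j ∈ range (i + 1), 1 ≤ ∑ j ∈ range (i + 1), f j := by
      apply sum_le_sum
      intro j hj
      have : f i ≤ f j := ha (by simp at hj; omega)
      omega
    simp at h2
    omega
  refine ⟨ha, hz', ?_⟩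
  rcases le_total n N with h | h
  · rw [← sum_range_eq_of_zero hz' h, hs]
  · rw [sum_range_eq_of_zero hz h, hs]

lemma isPart_iff {n : ℕ} {f : ℕ → ℕ} : IsPart n f ↔ IsPtnFun f ∧ psize f = n := by
  constructor
  · intro h
    exact ⟨⟨h.anti, n, h.zero⟩, by rw [psize_eq_sum h.zero, h.sum]⟩
  · rintro ⟨⟨ha, N, hN⟩, hs⟩
    exact IsPart.of ha hN (by rw [← psize_eq_sum hN, hs])

lemma IsPart.psize_eq {n : ℕ} {f : ℕ → ℕ} (h : IsPart n f) : psize f = n := (isPart_iff.1 h).2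

lemma IsPart.le {n : ℕ} {f : ℕ → ℕ} (h : IsPart n f) (i : ℕ) : f i ≤ n := by
  by_cases hi : i < n
  · rw [← h.sum]
    exact single_le_sum (f := f) (fun _ _ => Nat.zero_le _) (mem_range.2 hi)
  · simp [h.zero i (not_lt.1 hi)]

lemma finite_isPart (n : ℕ) : {f | IsPart n f}.Finite := by
  apply Set.Finite.of_injOn (t := Set.univ)
    (f := fun (f : ℕ → ℕ) => fun i : Fin n => (Fin.ofNat (n + 1) (f i)))
  · intro f _; simp
  · intro f hf g hg h
    funext i
    by_cases hi : i < n
    · have := congrFun h ⟨i, hi⟩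
      have h3 := congrArg Fin.val this
      simp only [Fin.ofNat] at h3
      rwa [Nat.mod_eq_of_lt (Nat.lt_succ_of_le (hf.le i)),
        Nat.mod_eq_of_lt (Nat.lt_succ_of_le (hg.le i))] at h3
    · rw [hf.zero i (not_lt.1 hi), hg.zero i (not_lt.1 hi)]
  · exact Set.finite_univ

/-- The finite set of partitions of `n`. -/
noncomputable def ptns (n : ℕ) : Finset (ℕ → ℕ) := (finite_isPart n).toFinset

lemma mem_ptns {n : ℕ} {f : ℕ → ℕ} : f ∈ ptns n ↔ IsPart n f := by simp [ptns]

/-- The rows from which a box can be removed. -/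
noncomputable def cor (f : ℕ → ℕ) : Finset ℕ := {i ∈ range (psize f) | f (i + 1) < f i}

/-- The rows to which a box can be added. -/
noncomputable def addable (f : ℕ → ℕ) : Finset ℕ := insert 0 ((cor f).image (· + 1))

/-- Add a box in row `i`. -/
def up (f : ℕ → ℕ) (i : ℕ) : ℕ → ℕ := Function.update f i (f i + 1)

/-- Remove a box from row `i`. -/
def dn (f : ℕ → ℕ) (i : ℕ) : ℕ → ℕ := Function.update f i (f i - 1)

lemma up_apply (f : ℕ → ℕ) (i j : ℕ) : up f i j = if j = i then f i + 1 else f j := by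
  simp [up, Function.update_apply]

lemma dn_apply (f : ℕ → ℕ) (i j : ℕ) : dn f i j = if j = i then f i - 1 else f j := by
  simp [dn, Function.update_apply]

variable {n : ℕ} {f : ℕ → ℕ}

lemma IsPart.mem_cor (h : IsPart n f) {i : ℕ} : i ∈ cor f ↔ f (i + 1) < f i := by
  simp only [cor, h.psize_eq, mem_filter, mem_range, and_iff_right_iff_imp]
  intro hi
  by_contra hn
  rw [h.zero i (not_lt.1 hn)] at hi
  omega

lemma IsPart.mem_addable (h : IsPart n f) {i : ℕ} :
    i ∈ addable f ↔ i = 0 ∨ f i < f (i - 1) := by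
  simp only [addable, mem_insert, mem_image, h.mem_cor]
  constructor
  · rintro (h | ⟨a, ha, rfl⟩)
    · exact Or.inl h
    · right; simpa using ha
  · rintro (h | h)
    · exact Or.inl h
    · rcases Nat.eq_zero_or_pos i with h0 | h0
      · exact Or.inl h0
      · right
        exact ⟨i - 1, by rwa [Nat.sub_add_cancel h0], Nat.sub_add_cancel h0⟩

lemma IsPart.dn (h : IsPart (n + 1) f) {i : ℕ} (hi : f (i + 1) < f i) : IsPart n (dn f i) := by
  have hin : i < n + 1 := by
    by_contra hn
    rw [h.zero i (not_lt.1 hn)] at hi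
    omega
  apply IsPart.of (N := n + 1)
  · apply antitone_nat_of_succ_le
    intro j
    have := h.anti (Nat.le_succ j)
    simp only [dn_apply]
    simp only [Nat.succ_eq_add_one] at this
    split_ifs with h1 h2 h2
    · omega
    · subst h1; omega
    · subst h2; omega
    · exact this
  · intro j hj
    have := h.zero j hj
    rw [dn_apply]
    split_ifs with h1
    · subst h1; omega
    · exact this
  · have h1 := h.sum
    rw [← add_sum_erase _ _ (mem_range.2 hin)] at h1 ⊢
    have h2 : ∑ x ∈ (range (n + 1)).erase i, Plancherel.dn f i x
        = ∑ x ∈ (range (n + 1)).erase i, f x := by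
      apply sum_congr rfl
      intro x hx
      rw [dn_apply, if_neg (ne_of_mem_erase hx)]
    rw [h2, dn_apply, if_pos rfl]
    omega

lemma IsPart.up (h : IsPart n f) {i : ℕ} (hi : i = 0 ∨ f i < f (i - 1)) :
    IsPart (n + 1) (up f i) := by
  have hin : i < n + 1 := by
    by_contra hn
    rcases hi with h1 | h1
    · omega
    · rw [h.zero (i - 1) (by omega)] at h1
      omega
  apply IsPart.of (N := n + 1)
  · apply antitone_nat_of_succ_le
    intro j
    have := h.anti (Nat.le_succ j)
    simp only [up_apply]
    simp only [Nat.succ_eq_add_one] at this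
    split_ifs with h1 h2 h2
    · omega
    · subst h1
      simp at hi
      omega
    · subst h2; omega
    · exact this
  · intro j hj
    have := h.zero j (by omega)
    rw [up_apply, if_neg (by omega), this]
  · have h1 := h.sum_range (N := n + 1) (by omega)
    rw [← add_sum_erase _ _ (mem_range.2 hin)] at h1 ⊢
    have h2 : ∑ x ∈ (range (n + 1)).erase i, Plancherel.up f i x
        = ∑ x ∈ (range (n + 1)).erase i, f x := by
      apply sum_congr rfl
      intro x hx
      rw [up_apply, if_neg (ne_of_mem_erase hx)]
    rw [h2, up_apply, if_pos rfl]
    omega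

lemma dn_up (f : ℕ → ℕ) (i : ℕ) : dn (up f i) i = f := by
  funext j; simp only [dn_apply, up_apply]; split_ifs with h1 <;> simp_all

lemma up_dn {f : ℕ → ℕ} {i : ℕ} (h : 0 < f i) : up (dn f i) i = f := by
  funext j; simp only [dn_apply, up_apply]; split_ifs with h1 <;> simp_all
  omega

/-- Exchange of summation over the edges of Young's graph between levels `n` and `n + 1`. -/
lemma sum_edges {A : Type*} [AddCommMonoid A] (n : ℕ) (G : (ℕ → ℕ) → ℕ → (ℕ → ℕ) → A) :
    ∑ f ∈ ptns (n + 1), ∑ i ∈ cor f, G f i (dn f i)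
      = ∑ g ∈ ptns n, ∑ i ∈ addable g, G (up g i) i g := by
  rw [sum_sigma', sum_sigma']
  refine sum_bij' (fun p _ => (⟨dn p.1 p.2, p.2⟩ : Σ _ : ℕ → ℕ, ℕ))
    (fun p _ => (⟨up p.1 p.2, p.2⟩ : Σ _ : ℕ → ℕ, ℕ)) ?_ ?_ ?_ ?_ ?_
  · rintro ⟨f, i⟩ h
    simp only [mem_sigma, mem_ptns] at h ⊢
    obtain ⟨h1, h2⟩ := h
    rw [h1.mem_cor] at h2
    have h3 := h1.dn h2
    refine ⟨h3, ?_⟩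
    rw [h3.mem_addable]
    rcases Nat.eq_zero_or_pos i with h0 | h0
    · exact Or.inl h0
    · right
      have := h1.anti (Nat.sub_le i 1)
      rw [dn_apply, dn_apply, if_pos rfl, if_neg (by omega)]
      omega
  · rintro ⟨f, i⟩ h
    simp only [mem_sigma, mem_ptns] at h ⊢
    obtain ⟨h1, h2⟩ := h
    rw [h1.mem_addable] at h2
    have h3 := h1.up h2
    refine ⟨h3, ?_⟩
    rw [h3.mem_cor, up_apply, up_apply, if_pos rfl, if_neg (by omega)]
    have := h1.anti (Nat.le_succ i)
    simp only [Nat.succ_eq_add_one] at this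
    omega
  · rintro ⟨f, i⟩ h
    simp only [mem_sigma, mem_ptns] at h
    obtain ⟨h1, h2⟩ := h
    rw [h1.mem_cor] at h2
    simp [up_dn (show 0 < f i by omega)]
  · rintro ⟨f, i⟩ h
    simp [dn_up]
  · rintro ⟨f, i⟩ h
    simp only [mem_sigma, mem_ptns] at h
    obtain ⟨h1, h2⟩ := h
    rw [h1.mem_cor] at h2
    simp [up_dn (show 0 < f i by omega)]

end

/-! ### The branching rule -/

section

open Finset

variable {n : ℕ} {f : ℕ → ℕ}

lemma cells_dn_iff {i : ℕ} (hi : 0 < f i) (p : ℕ × ℕ) :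
    p.2 < dn f i p.1 ↔ p.2 < f p.1 ∧ p ≠ (i, f i - 1) := by
  obtain ⟨a, b⟩ := p
  rw [dn_apply]
  simp only [ne_eq, Prod.mk.injEq, not_and]
  split_ifs with h
  · subst h; simp; omega
  · simp [h]

lemma isSYT_insert (h : IsPart (n + 1) f) {i : ℕ} (hi : f (i + 1) < f i) {T : ℕ × ℕ → ℕ}
    (hT : IsSYT (dn f i) T) : IsSYT f (Function.update T (i, f i - 1) (n + 1)) := by
  have h0 : 0 < f i := by omega
  obtain ⟨hz, hr, hc, hb⟩ := hT
  rw [(h.dn hi).psize_eq] at hb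
  have hle : ∀ p, T p ≤ n := by
    intro p
    by_cases hp : p.2 < dn f i p.1
    · exact (hb.mapsTo hp).2
    · rw [hz p hp]; omega
  refine ⟨?_, ?_, ?_, ?_⟩
  · intro p hp
    rw [Function.update_of_ne, hz]
    · rw [cells_dn_iff h0]; tauto
    · rintro rfl; simp at hp; omega
  · intro a b hab
    rw [Function.update_apply, Function.update_apply]
    have hne : (a, b) ≠ (i, f i - 1) := by
      simp only [ne_eq, Prod.mk.injEq, not_and]; rintro rfl; omega
    rw [if_neg hne]
    split_ifs with h1
    · exact Nat.lt_succ_of_le (hle _)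
    · exact hr a b ((cells_dn_iff h0 (a, b + 1)).2 ⟨hab, h1⟩)
  · intro a b hab
    rw [Function.update_apply, Function.update_apply]
    have hne : (a, b) ≠ (i, f i - 1) := by
      simp only [ne_eq, Prod.mk.injEq, not_and]; rintro rfl; omega
    rw [if_neg hne]
    split_ifs with h1
    · exact Nat.lt_succ_of_le (hle _)
    · exact hc a b ((cells_dn_iff h0 (a + 1, b)).2 ⟨hab, h1⟩)
  · rw [h.psize_eq]
    have hcell : {p : ℕ × ℕ | p.2 < f p.1}
        = insert (i, f i - 1) {p : ℕ × ℕ | p.2 < dn f i p.1} := by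
      ext p
      simp only [Set.mem_ofPred_eq, Set.mem_insert_iff, cells_dn_iff h0]
      by_cases hp : p = (i, f i - 1)
      · subst hp; simp; omega
      · simp [hp]
    have hIcc : Set.Icc 1 (n + 1) = insert (n + 1) (Set.Icc 1 n) := by
      ext x; simp; omega
    rw [hcell, hIcc]
    have hb' : Set.BijOn (Function.update T (i, f i - 1) (n + 1))
        {p : ℕ × ℕ | p.2 < dn f i p.1} (Set.Icc 1 n) := by
      refine hb.congr ?_
      intro p hp
      rw [Set.mem_ofPred_eq, cells_dn_iff h0] at hp
      rw [Function.update_of_ne hp.2]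
    have := hb'.insert (a := (i, f i - 1)) (by simp)
    simpa using this

lemma isSYT_erase (h : IsPart (n + 1) f) {T : ℕ × ℕ → ℕ} (hT : IsSYT f T) :
    ∃ i, f (i + 1) < f i ∧ T (i, f i - 1) = n + 1 ∧
      IsSYT (dn f i) (Function.update T (i, f i - 1) 0) := by
  obtain ⟨hz, hr, hc, hb⟩ := hT
  rw [h.psize_eq] at hb
  obtain ⟨⟨i, j⟩, hp, hpT⟩ := hb.surjOn (show n + 1 ∈ Set.Icc 1 (n + 1) by simp)
  simp only [Set.mem_ofPred_eq] at hp
  have hle : ∀ p, T p ≤ n + 1 := by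
    intro p
    by_cases hp : p.2 < f p.1
    · exact (hb.mapsTo hp).2
    · rw [hz p hp]; omega
  have hj : j = f i - 1 := by
    by_contra hne
    have := hr i j (by omega)
    have := hle (i, j + 1)
    omega
  have hi : f (i + 1) < f i := by
    by_contra hne
    have := hc i j (by omega)
    have := hle (i + 1, j)
    omega
  subst hj
  have h0 : 0 < f i := by omega
  refine ⟨i, hi, hpT, ?_, ?_, ?_, ?_⟩
  · intro p hp'
    rw [cells_dn_iff h0] at hp'
    rw [Function.update_apply]
    split_ifs with h1
    · rfl
    · exact hz p (by tauto)
  · intro a b hab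
    have h1 := (cells_dn_iff h0 (a, b + 1)).1 hab
    have h2 := (cells_dn_iff h0 (a, b)).1 (show b < dn f i a by omega)
    rw [Function.update_of_ne h1.2, Function.update_of_ne h2.2]
    exact hr a b h1.1
  · intro a b hab
    have h1 := (cells_dn_iff h0 (a + 1, b)).1 hab
    have h2 := (cells_dn_iff h0 (a, b)).1
      (lt_of_lt_of_le hab ((h.dn hi).anti (Nat.le_succ a)))
    rw [Function.update_of_ne h1.2, Function.update_of_ne h2.2]
    exact hc a b h1.1
  · rw [(h.dn hi).psize_eq]
    have h1 : Set.BijOn T ({p : ℕ × ℕ | p.2 < f p.1} \ {(i, f i - 1)})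
        (Set.Icc 1 (n + 1) \ {n + 1}) := by
      have h2 := hb.sdiff_singleton (a := (i, f i - 1)) hp
      rwa [hpT] at h2
    have hIcc : Set.Icc 1 (n + 1) \ {n + 1} = Set.Icc 1 n := by
      ext x; simp only [Set.mem_sdiff, Set.mem_Icc, Set.mem_singleton_iff]; omega
    have hcell : {p : ℕ × ℕ | p.2 < f p.1} \ {(i, f i - 1)}
        = {p : ℕ × ℕ | p.2 < dn f i p.1} := by
      ext p
      simp only [Set.mem_sdiff, Set.mem_ofPred_eq, Set.mem_singleton_iff, cells_dn_iff h0, ne_eq]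
    rw [hIcc, hcell] at h1
    refine h1.congr ?_
    intro p hp
    rw [Set.mem_ofPred_eq, cells_dn_iff h0] at hp
    rw [Function.update_of_ne hp.2]

/-- Removing the largest entry of a standard Young tableau. -/
noncomputable def sytEquiv (h : IsPart (n + 1) f) :
    (Σ i : cor f, {T : ℕ × ℕ → ℕ // IsSYT (dn f i) T}) ≃ {T : ℕ × ℕ → ℕ // IsSYT f T} :=
  Equiv.ofBijective
    (fun p => ⟨Function.update p.2.1 (p.1.1, f p.1.1 - 1) (n + 1),
      isSYT_insert h (h.mem_cor.1 p.1.2) p.2.2⟩) (by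
    constructor
    · rintro ⟨⟨i, hi⟩, T, hT⟩ ⟨⟨j, hj⟩, U, hU⟩ heq
      have hi' := h.mem_cor.1 hi
      have hj' := h.mem_cor.1 hj
      simp only [Subtype.mk.injEq] at heq
      have hij : i = j := by
        have hb := (isSYT_insert h hi' hT).2.2.2
        have := hb.injOn (x₁ := (i, f i - 1)) (x₂ := (j, f j - 1))
          (by simp; omega) (by simp; omega)
          (by rw [Function.update_self, heq, Function.update_self])
        simpa using congrArg Prod.fst this
      subst hij
      have hTU : T = U := by
        funext p
        by_cases hp : p = (i, f i - 1)
        · subst hp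
          rw [hT.1 _ (by rw [cells_dn_iff (show 0 < f i by omega)]; simp),
            hU.1 _ (by rw [cells_dn_iff (show 0 < f i by omega)]; simp)]
        · have := congrFun heq p
          rwa [Function.update_of_ne hp, Function.update_of_ne hp] at this
      subst hTU
      rfl
    · rintro ⟨T, hT⟩
      obtain ⟨i, hi, hTi, hT'⟩ := isSYT_erase h hT
      refine ⟨⟨⟨i, h.mem_cor.2 hi⟩, _, hT'⟩, ?_⟩
      simp only [Subtype.mk.injEq, Function.update_idem]
      rw [← hTi, Function.update_eq_self])

lemma isSYT_zero (h : IsPart 0 f) (T : ℕ × ℕ → ℕ) : IsSYT f T ↔ T = 0 := by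
  have hf : ∀ i, f i = 0 := fun i => h.zero i (Nat.zero_le i)
  constructor
  · intro hT
    funext p
    exact hT.1 p (by simp [hf])
  · rintro rfl
    refine ⟨by simp, by simp [hf], by simp [hf], ?_⟩
    rw [h.psize_eq]
    simp [hf]

lemma finite_isSYT (n : ℕ) : ∀ f, IsPart n f → Finite {T : ℕ × ℕ → ℕ // IsSYT f T} := by
  induction n with
  | zero =>
    intro f h
    have : {T : ℕ × ℕ → ℕ | IsSYT f T} = {0} := by ext T; simp [isSYT_zero h]
    have h2 : ({T : ℕ × ℕ → ℕ | IsSYT f T} : Set _).Finite := by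
      rw [this]; exact Set.finite_singleton _
    exact h2.to_subtype
  | succ n ih =>
    intro f h
    have : ∀ i : cor f, Finite {T : ℕ × ℕ → ℕ // IsSYT (dn f i) T} :=
      fun i => ih _ (h.dn (h.mem_cor.1 i.2))
    exact Finite.of_equiv _ (sytEquiv h)

lemma sytCount_zero (h : IsPart 0 f) : sytCount f = 1 := by
  have : {T : ℕ × ℕ → ℕ | IsSYT f T} = {0} := by ext T; simp [isSYT_zero h]
  change Nat.card ({T : ℕ × ℕ → ℕ | IsSYT f T} : Set _) = 1
  rw [this]; simp

/-- The branching rule. -/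
lemma sytCount_succ (h : IsPart (n + 1) f) :
    sytCount f = ∑ i ∈ cor f, sytCount (dn f i) := by
  have : ∀ i : cor f, Finite {T : ℕ × ℕ → ℕ // IsSYT (dn f i) T} :=
      fun i => finite_isSYT n _ (h.dn (h.mem_cor.1 i.2))
  rw [sytCount, ← Nat.card_congr (sytEquiv h), Nat.card_sigma,
    ← Finset.sum_coe_sort (cor f) (fun i => sytCount (dn f i))]
  rfl

end

/-! ### Second moment of the content sum -/

section

open Finset

variable {n : ℕ} {f : ℕ → ℕ}

/-- The number of standard Young tableaux, as a real number. -/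
noncomputable def dimR (f : ℕ → ℕ) : ℝ := sytCount f

lemma dimR_nonneg (f : ℕ → ℕ) : 0 ≤ dimR f := Nat.cast_nonneg _

lemma dimR_zero (h : IsPart 0 f) : dimR f = 1 := by simp [dimR, sytCount_zero h]

lemma dimR_succ (h : IsPart (n + 1) f) : dimR f = ∑ i ∈ cor f, dimR (dn f i) := by
  simp [dimR, sytCount_succ h]

/-- Weighted sum of the dimensions of the upper neighbours of a partition. -/
noncomputable def upSum (g : ℤ → ℝ) (f : ℕ → ℕ) : ℝ :=
  ∑ i ∈ addable f, dimR (up f i) * g (f i - i)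

lemma dn_up_comm (f : ℕ → ℕ) {i j : ℕ} (h : i ≠ j) : dn (up f i) j = up (dn f j) i := by
  funext k
  simp only [dn_apply, up_apply]
  split_ifs <;> omega

lemma sum_addable_sub_sum_cor (h : IsPart n f) (g : ℤ → ℝ) :
    ∑ i ∈ addable f, g (f i - i) - ∑ j ∈ cor f, g (f j - 1 - j)
      = g (f 0) + ∑ j ∈ range n, (g (f (j + 1) - (j + 1)) - g (f j - 1 - j)) := by
  have h1 : ∑ i ∈ addable f, g (f i - i) = g (f 0) + ∑ j ∈ cor f, g (f (j + 1) - (j + 1)) := by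
    rw [addable, sum_insert (by simp), sum_image (by simp)]
    simp
  rw [h1, add_sub_assoc, ← sum_sub_distrib]
  congr 1
  have h2 : cor f ⊆ range n := by
    intro i hi
    rw [cor, h.psize_eq] at hi
    exact (mem_filter.1 hi).1
  apply sum_subset h2
  intro j _ hj
  rw [h.mem_cor] at hj
  have := h.anti (Nat.le_succ j)
  simp only [Nat.succ_eq_add_one] at this
  have h3 : f (j + 1) = f j := by omega
  rw [h3, sub_eq_zero]
  congr 1
  ring

lemma upSum_succ (h : IsPart (n + 1) f) (g : ℤ → ℝ) :
    upSum g f = dimR f * (g (f 0) + ∑ j ∈ range (n + 1),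
        (g (f (j + 1) - (j + 1)) - g (f j - 1 - j)))
      + ∑ j ∈ cor f, upSum g (dn f j) := by
  rw [← sum_addable_sub_sum_cor h]
  have hL : upSum g f = ∑ i ∈ addable f, dimR f * g (f i - i)
      + ∑ i ∈ addable f, ∑ j ∈ (cor (up f i)).erase i, dimR (dn (up f i) j) * g (f i - i) := by
    rw [upSum, ← sum_add_distrib]
    apply sum_congr rfl
    intro i hi
    have hu := h.up (h.mem_addable.1 hi)
    have hi' : i ∈ cor (up f i) := by
      rw [hu.mem_cor, up_apply, up_apply, if_pos rfl, if_neg (by omega)]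
      have := h.anti (Nat.le_succ i)
      simp only [Nat.succ_eq_add_one] at this
      omega
    rw [dimR_succ hu, sum_mul, ← add_sum_erase _ _ hi', dn_up]
  have hR : ∑ j ∈ cor f, upSum g (dn f j) = ∑ j ∈ cor f, dimR f * g (f j - 1 - j)
      + ∑ j ∈ cor f, ∑ i ∈ (addable (dn f j)).erase j, dimR (up (dn f j) i) * g (f i - i) := by
    rw [← sum_add_distrib]
    apply sum_congr rfl
    intro j hj
    rw [h.mem_cor] at hj
    have hd := h.dn hj
    have hj' : j ∈ addable (dn f j) := by
      rw [hd.mem_addable, dn_apply, dn_apply, if_pos rfl]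
      rcases Nat.eq_zero_or_pos j with h0 | h0
      · exact Or.inl h0
      · right
        rw [if_neg (by omega)]
        have := h.anti (Nat.sub_le j 1)
        omega
    rw [upSum, ← add_sum_erase _ _ hj', up_dn (by omega)]
    congr 1
    · rw [dn_apply, if_pos rfl, Nat.cast_sub (by omega)]
      simp
    · apply sum_congr rfl
      intro i hi
      rw [dn_apply, if_neg (ne_of_mem_erase hi)]
  have hS : ∑ i ∈ addable f, ∑ j ∈ (cor (up f i)).erase i, dimR (dn (up f i) j) * g (f i - i)
      = ∑ j ∈ cor f, ∑ i ∈ (addable (dn f j)).erase j, dimR (up (dn f j) i) * g (f i - i) := by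
    have : ∀ i ∈ addable f,
        ∑ j ∈ (cor (up f i)).erase i, dimR (dn (up f i) j) * g (f i - i)
        = ∑ j ∈ (cor (up f i)).erase i, dimR (up (dn f j) i) * g (f i - i) := by
      intro i _
      apply sum_congr rfl
      intro j hj
      rw [dn_up_comm f (ne_of_mem_erase hj).symm]
    rw [sum_congr rfl this]
    apply sum_comm'
    intro i j
    simp only [mem_erase]
    constructor
    · rintro ⟨hi, hne, hj⟩
      have hi' := h.mem_addable.1 hi
      have hj' := (h.up hi').mem_cor.1 hj
      simp only [up_apply, if_neg hne] at hj'
      have hj2 : f (j + 1) < f j := by split_ifs at hj' with h1 <;> [subst h1; skip] <;> omega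
      refine ⟨⟨Ne.symm hne, ?_⟩, h.mem_cor.2 hj2⟩
      rw [(h.dn hj2).mem_addable]
      simp only [dn_apply, if_neg (Ne.symm hne)]
      rcases hi' with h0 | h0
      · exact Or.inl h0
      · by_cases hi0 : i = 0
        · exact Or.inl hi0
        right
        split_ifs with h1
        · have : j + 1 = i := by omega
          rw [if_pos this] at hj'
          omega
        · exact h0
    · rintro ⟨⟨hne, hi⟩, hj⟩
      have hj' := h.mem_cor.1 hj
      have hi' := (h.dn hj').mem_addable.1 hi
      simp only [dn_apply, if_neg hne] at hi'
      have hi2 : i = 0 ∨ f i < f (i - 1) := by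
        rcases hi' with h0 | h0
        · exact Or.inl h0
        · right
          split_ifs at h0 with h1 <;> [rw [h1]; skip] <;> omega
      refine ⟨h.mem_addable.2 hi2, Ne.symm hne, ?_⟩
      rw [(h.up hi2).mem_cor]
      simp only [up_apply, if_neg (Ne.symm hne)]
      split_ifs with h1
      · subst h1
        simp at hi'
        omega
      · exact hj'
  rw [hL, hR, hS, ← mul_sum, ← mul_sum]
  ring

lemma upSum_zero (h : IsPart 0 f) (g : ℤ → ℝ) : upSum g f = g 0 := by
  have hc : cor f = ∅ := by simp [cor, h.psize_eq]
  have h0 : ∀ i, f i = 0 := fun i => h.zero i (Nat.zero_le i)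
  have h1 := h.up (i := 0) (Or.inl rfl)
  have hf : f = 0 := funext h0
  have : dimR (up f 0) = 1 := by
    have hc1 : cor (up f 0) = {0} := by
      ext i
      rw [h1.mem_cor, up_apply, up_apply]
      by_cases hi : i = 0 <;> simp [h0, hi]
    rw [dimR_succ h1, hc1, sum_singleton, dn_up, dimR_zero h]
  simp [upSum, addable, hc, this, h0]

lemma upSum_one (n : ℕ) : ∀ f, IsPart n f → upSum (fun _ => 1) f = (n + 1) * dimR f := by
  induction n with
  | zero => intro f h; simp [upSum_zero h, dimR_zero h]
  | succ n ih =>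
    intro f h
    rw [upSum_succ h, sum_congr rfl (fun j hj => ih _ (h.dn (h.mem_cor.1 hj))), ← mul_sum,
      ← dimR_succ h]
    simp
    ring

lemma upSum_id (n : ℕ) : ∀ f, IsPart n f → upSum (fun c => (c : ℝ)) f = 0 := by
  induction n with
  | zero => intro f h; simp [upSum_zero h]
  | succ n ih =>
    intro f h
    rw [upSum_succ h, sum_congr rfl (fun j hj => ih _ (h.dn (h.mem_cor.1 hj)))]
    have : ∑ j ∈ range (n + 1), ((((f (j + 1) : ℤ) - (j + 1) : ℤ) : ℝ) -
        (((f j : ℤ) - 1 - j : ℤ) : ℝ))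
        = ∑ j ∈ range (n + 1), ((f (j + 1) : ℝ) - f j) := by
      apply sum_congr rfl
      intro j _
      push_cast
      ring
    rw [this, sum_range_sub (fun j => (f j : ℝ)), h.zero (n + 1) le_rfl]
    simp

lemma upSum_sq (n : ℕ) :
    ∀ f, IsPart n f → upSum (fun c => (c : ℝ) ^ 2) f = n * (n + 1) * dimR f := by
  induction n with
  | zero => intro f h; simp [upSum_zero h]
  | succ n ih =>
    intro f h
    rw [upSum_succ h, sum_congr rfl (fun j hj => ih _ (h.dn (h.mem_cor.1 hj))), ← mul_sum,
      ← dimR_succ h]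
    have h1 : ∑ j ∈ range (n + 1),
        ((((f (j + 1) : ℤ) - (j + 1) : ℤ) : ℝ) ^ 2 - (((f j : ℤ) - 1 - j : ℤ) : ℝ) ^ 2)
        = ∑ j ∈ range (n + 1),
          ((((f (j + 1) : ℝ) - ((j + 1 : ℕ) : ℝ)) ^ 2 + ((j + 1 : ℕ) : ℝ) ^ 2) -
          (((f j : ℝ) - (j : ℕ)) ^ 2 + ((j : ℕ) : ℝ) ^ 2)) + 2 * ∑ j ∈ range (n + 1), (f j : ℝ)
          - 2 * ∑ j ∈ range (n + 1), ((2 * j + 1 : ℕ) : ℝ) := by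
      rw [mul_sum, mul_sum, ← sum_add_distrib, ← sum_sub_distrib]
      apply sum_congr rfl
      intro j _
      push_cast
      ring
    have h2 : ∑ j ∈ range (n + 1), (f j : ℝ) = n + 1 := by
      have := h.sum
      exact_mod_cast this
    have h3 : ∑ j ∈ range (n + 1), ((2 * j + 1 : ℕ) : ℝ) = (n + 1) ^ 2 := by
      rw [← Nat.cast_sum]
      have : ∀ N, ∑ j ∈ range N, (2 * j + 1) = N ^ 2 := by
        intro N
        induction N with
        | zero => simp
        | succ N ih => rw [sum_range_succ, ih]; ring
      rw [this]; push_cast; ring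
    rw [h1, h2, h3,
      sum_range_sub (fun j => (((f j : ℝ) - (j : ℕ)) ^ 2 + ((j : ℕ) : ℝ) ^ 2)),
      h.zero (n + 1) le_rfl]
    push_cast
    ring

lemma sum_dimR_sq (n : ℕ) : ∑ f ∈ ptns n, dimR f ^ 2 = n.factorial := by
  induction n with
  | zero =>
    have : ptns 0 = {0} := by
      ext f
      rw [mem_ptns, mem_singleton]
      constructor
      · intro h
        funext i
        exact h.zero i (Nat.zero_le i)
      · rintro rfl
        exact ⟨antitone_const, by simp, by simp⟩
    have h0 : IsPart 0 0 := ⟨antitone_const, by simp, by simp⟩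
    simp [this, dimR_zero h0]
  | succ n ih =>
    have h1 : ∑ f ∈ ptns (n + 1), dimR f ^ 2
        = ∑ f ∈ ptns (n + 1), ∑ i ∈ cor f, dimR f * dimR (dn f i) := by
      apply sum_congr rfl
      intro f hf
      rw [← mul_sum, ← dimR_succ (mem_ptns.1 hf), sq]
    rw [h1, sum_edges n (fun f _ g => dimR f * dimR g)]
    have h2 : ∀ g ∈ ptns n, ∑ i ∈ addable g, dimR (up g i) * dimR g = (n + 1) * dimR g ^ 2 := by
      intro g hg
      have := upSum_one n g (mem_ptns.1 hg)
      simp only [upSum, mul_one] at this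
      rw [← sum_mul, this]
      ring
    rw [sum_congr rfl h2, ← mul_sum, ih, Nat.factorial_succ]
    push_cast
    ring

/-- Twice the sum of the contents of a partition. -/
noncomputable def twoContent (f : ℕ → ℕ) : ℝ :=
  ∑ i ∈ range (psize f), ((f i : ℝ) * (f i - 1) - 2 * i * f i)

lemma IsPart.twoContent_eq (h : IsPart n f) {N : ℕ} (hN : ∀ i, N ≤ i → f i = 0) :
    twoContent f = ∑ i ∈ range N, ((f i : ℝ) * (f i - 1) - 2 * i * f i) := by
  rw [twoContent, h.psize_eq]
  rcases le_total n N with h1 | h1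
  · apply sum_subset (by simpa using h1)
    intro i _ hi
    simp [h.zero i (by simpa using hi)]
  · symm
    apply sum_subset (by simpa using h1)
    intro i _ hi
    simp [hN i (by simpa using hi)]

lemma IsPart.twoContent_up (h : IsPart n f) {i : ℕ} (hi : i ∈ addable f) :
    twoContent (Plancherel.up f i) = twoContent f + 2 * (((f i : ℤ) - i : ℤ) : ℝ) := by
  have hu := h.up (h.mem_addable.1 hi)
  rw [hu.twoContent_eq hu.zero, h.twoContent_eq (N := n + 1) (fun i hi => h.zero i (by omega))]
  have hin : i < n + 1 := by
    by_contra hn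
    have := hu.zero i (not_lt.1 hn)
    rw [up_apply, if_pos rfl] at this
    omega
  rw [← add_sum_erase _ _ (mem_range.2 hin), ← add_sum_erase _ _ (mem_range.2 hin)]
  have : ∑ x ∈ (range (n + 1)).erase i,
      (((Plancherel.up f i x : ℕ) : ℝ) * ((Plancherel.up f i x : ℕ) - 1) -
        2 * x * (Plancherel.up f i x : ℕ))
      = ∑ x ∈ (range (n + 1)).erase i, ((f x : ℝ) * (f x - 1) - 2 * x * f x) := by
    apply sum_congr rfl
    intro x hx
    rw [up_apply, if_neg (ne_of_mem_erase hx)]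
  rw [this, up_apply, if_pos rfl]
  push_cast
  ring

lemma sum_dimR_sq_mul_twoContent_sq (n : ℕ) :
    ∑ f ∈ ptns n, dimR f ^ 2 * twoContent f ^ 2 = 2 * n * (n - 1) * n.factorial := by
  induction n with
  | zero =>
    simp only [CharP.cast_eq_zero, mul_zero, zero_mul]
    apply sum_eq_zero
    intro f hf
    have h := mem_ptns.1 hf
    simp [twoContent, h.psize_eq]
  | succ n ih =>
    have h1 : ∑ f ∈ ptns (n + 1), dimR f ^ 2 * twoContent f ^ 2
        = ∑ f ∈ ptns (n + 1), ∑ i ∈ cor f, dimR f * dimR (dn f i) * twoContent f ^ 2 := by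
      apply sum_congr rfl
      intro f hf
      rw [← sum_mul, ← mul_sum, ← dimR_succ (mem_ptns.1 hf), sq]
    rw [h1, sum_edges n (fun f _ g => dimR f * dimR g * twoContent f ^ 2)]
    have h2 : ∀ g ∈ ptns n, ∑ i ∈ addable g, dimR (up g i) * dimR g * twoContent (up g i) ^ 2
        = (n + 1) * (dimR g ^ 2 * twoContent g ^ 2) + 4 * n * (n + 1) * dimR g ^ 2 := by
      intro g hg
      have hg := mem_ptns.1 hg
      have e1 := upSum_one n g hg
      have e2 := upSum_id n g hg
      have e3 := upSum_sq n g hg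
      have : ∑ i ∈ addable g, dimR (up g i) * dimR g * twoContent (up g i) ^ 2
          = dimR g * (twoContent g ^ 2 * upSum (fun _ => 1) g
            + 4 * twoContent g * upSum (fun c => (c : ℝ)) g
            + 4 * upSum (fun c => (c : ℝ) ^ 2) g) := by
        simp only [upSum, mul_sum, ← sum_add_distrib]
        apply sum_congr rfl
        intro i hi
        rw [hg.twoContent_up hi]
        ring
      rw [this, e1, e2, e3]
      ring
    rw [sum_congr rfl h2, sum_add_distrib, ← mul_sum, ← mul_sum, ih, sum_dimR_sq,
      Nat.factorial_succ]
    push_cast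
    ring

end

/-! ### The Plancherel measure -/

section

open Finset Filter Topology

variable {n : ℕ} {f : ℕ → ℕ}

open Classical in
/-- The Plancherel probability of a property of partitions of `n`. -/
noncomputable def pr (n : ℕ) (P : (ℕ → ℕ) → Prop) : ℝ :=
  (∑ f ∈ ptns n with P f, dimR f ^ 2) / n.factorial

lemma pr_eq (n : ℕ) (P : (ℕ → ℕ) → Prop) [DecidablePred P] :
    pr n P = (∑ f ∈ ptns n with P f, dimR f ^ 2) / n.factorial := by
  unfold pr
  congr!

lemma pr_nonneg (n : ℕ) (P : (ℕ → ℕ) → Prop) : 0 ≤ pr n P := by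
  unfold pr; positivity

lemma pr_mono {P Q : (ℕ → ℕ) → Prop} (h : ∀ f, IsPart n f → P f → Q f) : pr n P ≤ pr n Q := by
  unfold pr
  gcongr with g hg
  exact h g (mem_ptns.1 hg)

lemma pr_or_le (P Q : (ℕ → ℕ) → Prop) : pr n (fun f => P f ∨ Q f) ≤ pr n P + pr n Q := by
  classical
  unfold pr
  rw [← add_div]
  gcongr
  rw [← sum_union_inter]
  refine le_add_of_le_of_nonneg ?_ (sum_nonneg fun _ _ => sq_nonneg _)
  refine sum_le_sum_of_subset_of_nonneg ?_ (fun _ _ _ => sq_nonneg _)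
  intro f
  simp only [mem_filter, mem_union]
  tauto

lemma pr_exists_le {ι : Type*} (s : Finset ι) (P : ι → (ℕ → ℕ) → Prop) :
    pr n (fun f => ∃ k ∈ s, P k f) ≤ ∑ k ∈ s, pr n (P k) := by
  classical
  induction s using Finset.induction_on with
  | empty => simp [pr]
  | insert a s ha ih =>
    rw [sum_insert ha]
    refine le_trans (pr_mono (Q := fun f => P a f ∨ ∃ k ∈ s, P k f) ?_) ?_
    · intro f _ ⟨k, hk, hP⟩
      rcases mem_insert.1 hk with rfl | hk
      · exact Or.inl hP
      · exact Or.inr ⟨k, hk, hP⟩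
    · exact le_trans (pr_or_le _ _) (by gcongr)

lemma pr_false (n : ℕ) : pr n (fun _ => False) = 0 := by simp [pr]

lemma pr_true (n : ℕ) : pr n (fun _ => True) = 1 := by
  have : (n.factorial : ℝ) ≠ 0 := by positivity
  simp [pr, sum_dimR_sq, this]

lemma pr_le_one (n : ℕ) (P : (ℕ → ℕ) → Prop) : pr n P ≤ 1 := by
  rw [← pr_true n]
  exact pr_mono fun _ _ _ => trivial

lemma one_sub_pr_not_le (n : ℕ) (P : (ℕ → ℕ) → Prop) : 1 - pr n (fun f => ¬ P f) ≤ pr n P := by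
  have h1 := pr_or_le (n := n) P (fun f => ¬ P f)
  have h2 : pr n (fun f => P f ∨ ¬ P f) = 1 := by
    rw [← pr_true n]
    congr 1
    funext f
    simp [em]
  linarith

lemma tendsto_pr_zero_of_le {P : ℕ → (ℕ → ℕ) → Prop} {u : ℕ → ℝ}
    (hu : Tendsto u atTop (𝓝 0)) (h : ∀ᶠ n in atTop, pr n (P n) ≤ u n) :
    Tendsto (fun n => pr n (P n)) atTop (𝓝 0) :=
  squeeze_zero' (Eventually.of_forall fun n => pr_nonneg n _) h hu

/-- The content sum is small compared to `n ^ (3 / 2)` with high probability. -/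
lemma tendsto_pr_twoContent :
    Tendsto (fun n : ℕ => pr n (fun f => n * √n / 50 < twoContent f)) atTop (𝓝 0) := by
  apply tendsto_pr_zero_of_le (u := fun n : ℕ => 5000 / n)
  · exact tendsto_const_div_atTop_nhds_zero_nat 5000
  · filter_upwards [eventually_gt_atTop 0] with n hn
    have hn' : (0 : ℝ) < n := by exact_mod_cast hn
    classical
    unfold pr
    rw [div_le_div_iff₀ (by positivity) hn']
    have h1 : ∀ f ∈ (ptns n).filter (fun f => n * √n / 50 < twoContent f),
        (n : ℝ) ^ 3 * dimR f ^ 2 ≤ 2500 * (dimR f ^ 2 * twoContent f ^ 2) := by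
      intro f hf
      have h2 := (mem_filter.1 hf).2
      have h3 : (n * √n / 50) ^ 2 ≤ twoContent f ^ 2 := by
        apply pow_le_pow_left₀ (by positivity) h2.le
      have h4 : √(n : ℝ) ^ 2 = n := Real.sq_sqrt hn'.le
      have h5 : (n : ℝ) ^ 3 ≤ 2500 * twoContent f ^ 2 := by
        calc (n : ℝ) ^ 3 = 2500 * (n * √n / 50) ^ 2 := by
              rw [div_pow, mul_pow, h4]; ring
          _ ≤ _ := by gcongr
      nlinarith [mul_le_mul_of_nonneg_right h5 (sq_nonneg (dimR f))]
    have h2 := sum_le_sum h1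
    rw [← mul_sum, ← mul_sum] at h2
    have h3 : ∑ f ∈ ptns n with n * √n / 50 < twoContent f, dimR f ^ 2 * twoContent f ^ 2
        ≤ ∑ f ∈ ptns n, dimR f ^ 2 * twoContent f ^ 2 :=
      sum_le_sum_of_subset_of_nonneg (filter_subset _ _) (fun _ _ _ => by positivity)
    rw [sum_dimR_sq_mul_twoContent_sq] at h3
    have h4 : (n : ℝ) ^ 2 * ((∑ f ∈ ptns n with n * √n / 50 < twoContent f, dimR f ^ 2) * n)
        ≤ n ^ 2 * (5000 * n.factorial) := by
      have : (2 * n * (n - 1) * n.factorial : ℝ) ≤ 2 * n ^ 2 * n.factorial := by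
        have : (0 : ℝ) < n.factorial := by positivity
        nlinarith [mul_pos hn' this]
      nlinarith
    exact le_of_mul_le_mul_left h4 (by positivity)

end

/-! ### Splitting tableaux into rows or columns -/

section

open Finset Filter Topology

variable {n : ℕ} {f : ℕ → ℕ}

lemma sum_range_dn {i r : ℕ} (hi : i < r) (h : 0 < f i) :
    ∑ j ∈ range r, dn f i j + 1 = ∑ j ∈ range r, f j := by
  rw [← add_sum_erase _ _ (mem_range.2 hi), ← add_sum_erase _ _ (mem_range.2 hi),
    dn_apply, if_pos rfl]
  have : ∑ x ∈ (range r).erase i, dn f i x = ∑ x ∈ (range r).erase i, f x := by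
    apply sum_congr rfl
    intro x hx
    rw [dn_apply, if_neg (ne_of_mem_erase hx)]
  omega

lemma sum_range_dn_of_le {i r : ℕ} (hi : r ≤ i) :
    ∑ j ∈ range r, dn f i j = ∑ j ∈ range r, f j := by
  apply sum_congr rfl
  intro x hx
  rw [dn_apply, if_neg (by simp at hx; omega)]

lemma IsPart.sum_le (h : IsPart n f) (r : ℕ) : ∑ j ∈ range r, f j ≤ n := by
  rw [← h.sum_range (N := n + r) (by omega)]
  exact sum_le_sum_of_subset (by simp)

lemma IsPart.tail (h : IsPart n f) {r S : ℕ} (hS : ∑ j ∈ range r, f j = S) :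
    IsPart (n - S) (fun i => f (r + i)) := by
  apply IsPart.of (N := n)
  · intro a b hab
    exact h.anti (by omega)
  · intro i hi
    exact h.zero _ (by omega)
  · have := h.sum_range (N := r + n) (by omega)
    rw [sum_range_add, hS] at this
    omega

/-- Splitting off the first `r` rows of a tableau. -/
lemma sytCount_le_of_rows (r n : ℕ) : ∀ f S, IsPart n f → ∑ j ∈ range r, f j = S →
    sytCount f ≤ n.choose S * r ^ S * sytCount (fun i => f (r + i)) := by
  induction n with
  | zero =>
    intro f S h hS
    have h0 : S = 0 := by have := h.sum_le r; omega
    subst h0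
    have := h.tail hS
    simp only [Nat.sub_zero] at this
    simp [sytCount_zero h, sytCount_zero this]
  | succ n ih =>
    intro f S h hS
    rw [sytCount_succ h, ← sum_filter_add_sum_filter_not (cor f) (fun i => i < r)]
    have h1 : ∑ i ∈ cor f with i < r, sytCount (dn f i)
        ≤ (if S = 0 then 0 else n.choose (S - 1)) * r ^ S * sytCount (fun i => f (r + i)) := by
      rcases Nat.eq_zero_or_pos S with h0 | h0
      · rw [if_pos h0, zero_mul, zero_mul, nonpos_iff_eq_zero]
        apply sum_eq_zero
        intro i hi
        simp only [mem_filter, h.mem_cor] at hi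
        have : f i ≤ ∑ j ∈ range r, f j :=
          single_le_sum (f := f) (fun _ _ => Nat.zero_le _) (mem_range.2 hi.2)
        omega
      · rw [if_neg (by omega)]
        have h2 : ∀ i ∈ (cor f).filter (fun i => i < r), sytCount (dn f i)
            ≤ n.choose (S - 1) * r ^ (S - 1) * sytCount (fun i => f (r + i)) := by
          intro i hi
          simp only [mem_filter, h.mem_cor] at hi
          have h3 := ih _ (S - 1) (h.dn hi.1) (by
            have := sum_range_dn hi.2 (show 0 < f i by omega)
            omega)
          have h4 : (fun j => dn f i (r + j)) = fun j => f (r + j) := by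
            funext j
            rw [dn_apply, if_neg (by omega)]
          rwa [h4] at h3
        refine (sum_le_card_nsmul _ _ _ h2).trans ?_
        have h5 : #{i ∈ cor f | i < r} ≤ r := by
          calc _ ≤ #(range r) := by
                apply card_le_card
                intro i hi
                exact mem_range.2 (mem_filter.1 hi).2
            _ = r := card_range r
        rw [smul_eq_mul]
        calc _ ≤ r * (n.choose (S - 1) * r ^ (S - 1) * sytCount (fun i => f (r + i))) := by gcongr
          _ = n.choose (S - 1) * (r ^ (S - 1) * r) * sytCount (fun i => f (r + i)) := by ring
          _ = _ := by rw [← pow_succ, Nat.sub_add_cancel h0]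
    have h2 : ∑ i ∈ cor f with ¬ i < r, sytCount (dn f i)
        ≤ n.choose S * r ^ S * sytCount (fun i => f (r + i)) := by
      have h3 : ∀ i ∈ (cor f).filter (fun i => ¬ i < r), sytCount (dn f i)
          ≤ n.choose S * r ^ S * sytCount (dn (fun i => f (r + i)) (i - r)) := by
        intro i hi
        simp only [mem_filter, h.mem_cor, not_lt] at hi
        have h3 := ih _ S (h.dn hi.1) (by rw [sum_range_dn_of_le hi.2, hS])
        have h4 : (fun j => dn f i (r + j)) = dn (fun j => f (r + j)) (i - r) := by
          funext j
          simp only [dn_apply]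
          split_ifs <;> first | omega | (congr 2; omega)
        rwa [h4] at h3
      refine (sum_le_sum h3).trans ?_
      rw [← mul_sum]
      rcases Nat.lt_or_ge n S with h4 | h4
      · rw [Nat.choose_eq_zero_of_lt h4]; simp
      · have h5 := h.tail hS
        rw [Nat.succ_sub h4] at h5
        rw [sytCount_succ h5]
        apply le_of_eq
        congr 1
        refine sum_nbij' (fun i => i - r) (fun i => r + i) ?_ ?_ ?_ ?_ ?_
        · intro i hi
          simp only [mem_filter, h.mem_cor, not_lt] at hi
          rw [h5.mem_cor, show r + (i - r + 1) = i + 1 by omega, show r + (i - r) = i by omega]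
          exact hi.1
        · intro i hi
          rw [h5.mem_cor] at hi
          simp only [mem_filter, h.mem_cor]
          exact ⟨hi, by omega⟩
        · intro i hi
          simp only [mem_filter] at hi
          omega
        · intro i _; omega
        · intro i _; rfl
    refine (Nat.add_le_add h1 h2).trans ?_
    rw [← add_mul, ← add_mul]
    gcongr
    rcases Nat.eq_zero_or_pos S with h0 | h0
    · simp [h0]
    · rw [if_neg (by omega)]
      obtain ⟨S, rfl⟩ := Nat.exists_eq_succ_of_ne_zero h0.ne'
      rw [Nat.succ_sub_one, Nat.choose_succ_succ]

lemma pr_rows_le (n r S : ℕ) (hS : S ≤ n) :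
    pr n (fun f => ∑ j ∈ range r, f j = S)
      ≤ (n + 1 : ℝ) ^ r * n.choose S * r ^ (2 * S) / S.factorial := by
  rw [pr_eq]
  have h1 : ∀ f ∈ (ptns n).filter (fun f => ∑ j ∈ range r, f j = S),
      dimR f ^ 2 ≤ ((n.choose S : ℝ) * r ^ S) ^ 2 * dimR (fun i => f (r + i)) ^ 2 := by
    intro f hf
    simp only [mem_filter, mem_ptns] at hf
    rw [← mul_pow]
    apply pow_le_pow_left₀ (dimR_nonneg f)
    have := sytCount_le_of_rows r n f S hf.1 hf.2
    unfold dimR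
    exact_mod_cast this
  have h2 : ∑ f ∈ ptns n with ∑ j ∈ range r, f j = S, dimR (fun i => f (r + i)) ^ 2
      ≤ (n + 1 : ℝ) ^ r * (n - S).factorial := by
    have h3 : (n + 1 : ℝ) ^ r * (n - S).factorial
        = ∑ p ∈ (univ : Finset (Fin r → Fin (n + 1))) ×ˢ ptns (n - S), dimR p.2 ^ 2 := by
      rw [sum_product]
      simp [sum_dimR_sq]
    rw [h3]
    have hinj : Set.InjOn (fun f : ℕ → ℕ =>
        ((fun i : Fin r => Fin.ofNat (n + 1) (f i)), fun i => f (r + i)))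
        ((ptns n).filter (fun f => ∑ j ∈ range r, f j = S) : Finset (ℕ → ℕ)) := by
      intro f hf g hg hfg
      simp only [coe_filter, mem_ptns, Set.mem_ofPred_eq] at hf hg
      simp only [Prod.mk.injEq] at hfg
      funext i
      by_cases hi : i < r
      · have h4 := congrArg Fin.val (congrFun hfg.1 ⟨i, hi⟩)
        simp only [Fin.ofNat] at h4
        rwa [Nat.mod_eq_of_lt (Nat.lt_succ_of_le (hf.1.le i)),
          Nat.mod_eq_of_lt (Nat.lt_succ_of_le (hg.1.le i))] at h4
      · have h4 := congrFun hfg.2 (i - r)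
        rwa [show r + (i - r) = i by omega] at h4
    classical
    rw [← sum_image (f := fun p : (Fin r → Fin (n + 1)) × (ℕ → ℕ) => dimR p.2 ^ 2) hinj]
    apply sum_le_sum_of_subset_of_nonneg
    · intro p hp
      obtain ⟨f, hf, rfl⟩ := mem_image.1 hp
      simp only [mem_filter, mem_ptns] at hf
      simp only [mem_product, mem_univ, true_and, mem_ptns]
      exact hf.1.tail hf.2
    · intro _ _ _; positivity
  have h3 := (sum_le_sum h1).trans (le_of_eq (mul_sum _ _ _).symm)
  have h4 : (n.choose S : ℝ) * S.factorial * (n - S).factorial = n.factorial := by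
    exact_mod_cast Nat.choose_mul_factorial_mul_factorial hS
  have hc : (0 : ℝ) < n.choose S := by exact_mod_cast Nat.choose_pos hS
  rw [div_le_div_iff₀ (by positivity) (by positivity), ← h4]
  calc _ ≤ (((n.choose S : ℝ) * r ^ S) ^ 2 * ((n + 1 : ℝ) ^ r * (n - S).factorial)) *
        S.factorial := by
        gcongr
        exact h3.trans (mul_le_mul_of_nonneg_left h2 (by positivity))
    _ = _ := by ring

lemma IsPart.sum_of_length (h : IsPart n f) {l : ℕ} (hl : ∀ i, 0 < f i ↔ i < l) :
    ∑ i ∈ range l, f i = n := by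
  rw [← psize_eq_sum (N := l), h.psize_eq]
  intro i hi
  by_contra hne
  have := (hl i).1 (Nat.pos_of_ne_zero hne)
  omega

lemma IsPart.tail_col (h : IsPart n f) {l : ℕ} (hl : ∀ i, 0 < f i ↔ i < l) :
    IsPart (n - l) (fun i => f i - 1) := by
  apply IsPart.of (N := l)
  · intro a b hab
    exact Nat.sub_le_sub_right (h.anti hab) 1
  · intro i hi
    have : ¬ 0 < f i := by rw [hl]; omega
    omega
  · have h1 := h.sum_of_length hl
    have h2 : ∑ i ∈ range l, f i = ∑ i ∈ range l, ((f i - 1) + 1) := by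
      apply sum_congr rfl
      intro i hi
      have := (hl i).2 (mem_range.1 hi)
      omega
    rw [h2, sum_add_distrib] at h1
    simp at h1
    omega

/-- Splitting off the first column of a tableau. -/
lemma sytCount_le_of_col (n : ℕ) : ∀ f l, IsPart n f → (∀ i, 0 < f i ↔ i < l) →
    sytCount f ≤ n.choose l * sytCount (fun i => f i - 1) := by
  induction n with
  | zero =>
    intro f l h hl
    have h0 : l = 0 := by
      by_contra h0
      have := (hl 0).2 (by omega)
      rw [h.zero 0 le_rfl] at this
      omega
    subst h0
    have := h.tail_col hl
    simp only [Nat.sub_zero] at this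
    simp [sytCount_zero h, sytCount_zero this]
  | succ n ih =>
    intro f l h hl
    have hl0 : 0 < l := by
      by_contra h0
      have := h.sum_of_length hl
      simp [show l = 0 by omega] at this
    rw [sytCount_succ h, ← sum_filter_add_sum_filter_not (cor f) (fun i => f i = 1)]
    have h1 : ∑ i ∈ cor f with f i = 1, sytCount (dn f i)
        ≤ n.choose (l - 1) * sytCount (fun i => f i - 1) := by
      have hi : ∀ i ∈ (cor f).filter (fun i => f i = 1), i = l - 1 := by
        intro i hi
        simp only [mem_filter, h.mem_cor] at hi
        have h1 := (hl i).1 (by omega)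
        have h2 : ¬ i + 1 < l := by rw [← hl]; omega
        omega
      have h2 : ∀ i ∈ (cor f).filter (fun i => f i = 1), sytCount (dn f i)
          ≤ n.choose (l - 1) * sytCount (fun i => f i - 1) := by
        intro i him
        have hil := hi i him
        simp only [mem_filter, h.mem_cor] at him
        have h3 := ih _ (l - 1) (h.dn him.1) (by
          intro j
          have := hl j
          rw [dn_apply]
          split_ifs with hj
          · subst hj; omega
          · omega)
        have h4 : (fun j => dn f i j - 1) = fun j => f j - 1 := by
          funext j
          rw [dn_apply]
          split_ifs with hj
          · subst hj; omega
          · rfl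
        rwa [h4] at h3
      refine (sum_le_card_nsmul _ _ _ h2).trans ?_
      have h5 : #{i ∈ cor f | f i = 1} ≤ 1 := by
        rw [card_le_one]
        intro a ha b hb
        rw [hi a ha, hi b hb]
      rw [smul_eq_mul]
      calc _ ≤ 1 * (n.choose (l - 1) * sytCount (fun i => f i - 1)) := by gcongr
        _ = _ := one_mul _
    have h2 : ∑ i ∈ cor f with ¬ f i = 1, sytCount (dn f i)
        ≤ n.choose l * sytCount (fun i => f i - 1) := by
      have h3 : ∀ i ∈ (cor f).filter (fun i => ¬ f i = 1), sytCount (dn f i)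
          ≤ n.choose l * sytCount (dn (fun i => f i - 1) i) := by
        intro i hi
        simp only [mem_filter, h.mem_cor] at hi
        have h3 := ih _ l (h.dn hi.1) (by
          intro j
          have := hl j
          rw [dn_apply]
          split_ifs with hj
          · subst hj; omega
          · omega)
        have h4 : (fun j => dn f i j - 1) = dn (fun j => f j - 1) i := by
          funext j
          simp only [dn_apply]
          split_ifs <;> omega
        rwa [h4] at h3
      refine (sum_le_sum h3).trans ?_
      rw [← mul_sum]
      rcases Nat.lt_or_ge n l with h4 | h4
      · rw [Nat.choose_eq_zero_of_lt h4]; simp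
      · have h5 := h.tail_col hl
        rw [Nat.succ_sub h4] at h5
        rw [sytCount_succ h5]
        gcongr
        intro i hi
        simp only [mem_filter, h.mem_cor] at hi
        rw [h5.mem_cor]
        omega
    refine (Nat.add_le_add h1 h2).trans ?_
    rw [← add_mul]
    gcongr
    obtain ⟨l, rfl⟩ := Nat.exists_eq_succ_of_ne_zero hl0.ne'
    rw [Nat.succ_sub_one, Nat.choose_succ_succ]

lemma pr_length_le (n l : ℕ) (hl : l ≤ n) :
    pr n (fun f => ∀ i, 0 < f i ↔ i < l) ≤ n.choose l / l.factorial := by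
  classical
  rw [pr_eq]
  have h1 : ∀ f ∈ (ptns n).filter (fun f => ∀ i, 0 < f i ↔ i < l),
      dimR f ^ 2 ≤ (n.choose l : ℝ) ^ 2 * dimR (fun i => f i - 1) ^ 2 := by
    intro f hf
    simp only [mem_filter, mem_ptns] at hf
    rw [← mul_pow]
    apply pow_le_pow_left₀ (dimR_nonneg f)
    have := sytCount_le_of_col n f l hf.1 hf.2
    unfold dimR
    exact_mod_cast this
  have h2 : ∑ f ∈ ptns n with ∀ i, 0 < f i ↔ i < l, dimR (fun i => f i - 1) ^ 2
      ≤ (n - l).factorial := by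
    rw [← sum_dimR_sq]
    have hinj : Set.InjOn (fun f : ℕ → ℕ => fun i => f i - 1)
        ((ptns n).filter (fun f => ∀ i, 0 < f i ↔ i < l) : Finset (ℕ → ℕ)) := by
      intro f hf g hg hfg
      simp only [coe_filter, Set.mem_ofPred_eq] at hf hg
      funext i
      have h4 := congrFun hfg i
      have := hf.2 i
      have := hg.2 i
      simp only at h4
      omega
    rw [← sum_image (f := fun p : ℕ → ℕ => dimR p ^ 2) hinj]
    apply sum_le_sum_of_subset_of_nonneg
    · intro p hp
      obtain ⟨f, hf, rfl⟩ := mem_image.1 hp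
      simp only [mem_filter, mem_ptns] at hf
      rw [mem_ptns]
      exact hf.1.tail_col hf.2
    · intro _ _ _; positivity
  have h3 := (sum_le_sum h1).trans (le_of_eq (mul_sum _ _ _).symm)
  have h4 : (n.choose l : ℝ) * l.factorial * (n - l).factorial = n.factorial := by
    exact_mod_cast Nat.choose_mul_factorial_mul_factorial hl
  have hc : (0 : ℝ) < n.choose l := by exact_mod_cast Nat.choose_pos hl
  rw [div_le_div_iff₀ (by positivity) (by positivity), ← h4]
  calc _ ≤ ((n.choose l : ℝ) ^ 2 * (n - l).factorial) * l.factorial := by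
        gcongr
        exact h3.trans (mul_le_mul_of_nonneg_left h2 (by positivity))
    _ = _ := by ring

lemma IsPart.exists_length (h : IsPart n f) : ∃ l ≤ n, ∀ i, 0 < f i ↔ i < l := by
  classical
  have hex : ∃ l, f l = 0 := ⟨n, h.zero n le_rfl⟩
  refine ⟨Nat.find hex, Nat.find_min' hex (h.zero n le_rfl), fun i => ?_⟩
  constructor
  · intro hi
    by_contra hn
    have := h.anti (not_lt.1 hn)
    rw [Nat.find_spec hex] at this
    omega
  · intro hi
    exact Nat.pos_of_ne_zero (Nat.find_min hex hi)

end

/-! ### Tail bounds for the length and for the first rows -/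

section

open Finset Filter Topology

lemma one_sub_le_exp_quadratic {x : ℝ} (h0 : 0 ≤ x) (h1 : x ≤ 1) :
    1 - x ≤ Real.exp (-(x + x ^ 2 / 2)) := by
  rcases eq_or_lt_of_le h1 with rfl | h1
  · simpa using (Real.exp_pos _).le
  have h := Real.hasSum_pow_div_log_of_abs_lt_one (x := x) (by rw [abs_of_nonneg h0]; exact h1)
  have h2 := sum_le_hasSum (range 2) (fun i _ => by positivity) h
  simp [sum_range_succ] at h2
  rw [← Real.log_le_iff_le_exp (by linarith)]
  norm_num at h2
  linarith

lemma descFactorial_le_exp (n S : ℕ) (hn : 0 < n) (hS : S ≤ n) :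
    (n.descFactorial S : ℝ) ≤ n ^ S * Real.exp (-(S * (((S : ℝ) - 1) / (2 * n)
      + ((S : ℝ) - 1) * (2 * S - 1) / (12 * n ^ 2)))) := by
  have hn' : (0 : ℝ) < n := by exact_mod_cast hn
  induction S with
  | zero => simp
  | succ S ih =>
    have ih := ih (by omega)
    have h2 : ((n - S : ℕ) : ℝ) = n * (1 - S / n) := by
      rw [Nat.cast_sub (by omega)]; field_simp
    have h3 : (S : ℝ) / n ≤ 1 := by
      rw [div_le_one hn']; exact_mod_cast (by omega : S ≤ n)
    have h4 := one_sub_le_exp_quadratic (x := (S : ℝ) / n) (by positivity) h3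
    rw [Nat.descFactorial_succ, Nat.cast_mul, h2]
    calc _ ≤ (n * Real.exp (-((S : ℝ) / n + ((S : ℝ) / n) ^ 2 / 2))) *
          (n ^ S * Real.exp (-(S * (((S : ℝ) - 1) / (2 * n)
            + ((S : ℝ) - 1) * (2 * S - 1) / (12 * n ^ 2))))) := by
          apply mul_le_mul _ ih (by positivity) (by positivity)
          gcongr
      _ = n ^ (S + 1) * (Real.exp (-((S : ℝ) / n + ((S : ℝ) / n) ^ 2 / 2)) *
          Real.exp (-(S * (((S : ℝ) - 1) / (2 * n)
            + ((S : ℝ) - 1) * (2 * S - 1) / (12 * n ^ 2))))) := by ring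
      _ = _ := by
          rw [← Real.exp_add]
          congr 2
          push_cast
          field_simp
          ring

lemma pow_self_le_exp_mul_factorial (l : ℕ) : (l : ℝ) ^ l ≤ Real.exp 1 ^ l * l.factorial := by
  have h := Real.pow_div_factorial_le_exp (l : ℝ) (Nat.cast_nonneg l) l
  rw [div_le_iff₀ (by positivity)] at h
  rwa [← Real.exp_nat_mul, mul_one]

lemma exp_one_sq_lt : Real.exp 1 ^ 2 < 7.38906 := by
  have h := Real.exp_one_lt_d9
  have h0 := Real.exp_pos 1
  nlinarith

lemma pow_le_exp_of_le {l : ℕ} {s : ℝ} (h : s ≤ l) :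
    (0.99 : ℝ) ^ l ≤ Real.exp (-(0.01 * s)) := by
  have h1 : (0.99 : ℝ) ≤ Real.exp (-0.01) := by
    have := Real.add_one_le_exp (-0.01)
    linarith
  calc (0.99 : ℝ) ^ l ≤ Real.exp (-0.01) ^ l := pow_le_pow_left₀ (by norm_num) h1 l
    _ = Real.exp (l * (-0.01)) := by rw [← Real.exp_nat_mul]
    _ ≤ _ := by apply Real.exp_le_exp.2; linarith

lemma tendsto_error :
    Tendsto (fun n : ℕ => ((n : ℝ) + 1) ^ 3 * Real.exp (-(0.02 * √n))) atTop (𝓝 0) := by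
  have hs : Tendsto (fun n : ℕ => √(n : ℝ)) atTop atTop :=
    Real.tendsto_sqrt_atTop.comp tendsto_natCast_atTop_atTop
  have h1 : Tendsto (fun x : ℝ => 8 * (x ^ 6 * Real.exp (-(0.02 * x)))) atTop (𝓝 0) := by
    have h := (Real.tendsto_pow_mul_exp_neg_atTop_nhds_zero 6).comp
      (tendsto_id.const_mul_atTop (show (0 : ℝ) < 0.02 by norm_num))
    have h2 := h.const_mul (8 / 0.02 ^ 6)
    simp only [mul_zero] at h2
    refine h2.congr fun x => ?_
    simp only [Function.comp, id]
    field_simp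
  refine squeeze_zero' (Eventually.of_forall fun n => by positivity) ?_ (h1.comp hs)
  filter_upwards [eventually_ge_atTop 1] with n hn
  have hn' : (1 : ℝ) ≤ n := by exact_mod_cast hn
  have h4 : √(n : ℝ) ^ 2 = n := Real.sq_sqrt (by linarith)
  have h5 : √(n : ℝ) ^ 6 = n ^ 3 := by rw [← h4]; ring_nf; rw [h4]
  simp only [Function.comp]
  rw [← mul_assoc, h5]
  gcongr
  calc ((n : ℝ) + 1) ^ 3 ≤ (2 * n) ^ 3 := by gcongr; linarith
    _ = _ := by ring

lemma choose_div_factorial_le {n l : ℕ} (hl : 2.8 * √n < l) :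
    (n.choose l : ℝ) / l.factorial ≤ 0.99 ^ l := by
  have h1 : (n.choose l : ℝ) ≤ n ^ l / l.factorial := Nat.choose_le_pow_div l n
  have hl0 : (0 : ℝ) < l := lt_of_le_of_lt (by positivity) hl
  have h2 := pow_self_le_exp_mul_factorial l
  have h3 : (n : ℝ) * Real.exp 1 ^ 2 ≤ 0.99 * l ^ 2 := by
    have h4 : √(n : ℝ) ^ 2 = n := Real.sq_sqrt (Nat.cast_nonneg n)
    have h5 : (2.8 * √(n : ℝ)) ^ 2 ≤ l ^ 2 := by gcongr
    have := exp_one_sq_lt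
    rw [mul_pow, h4] at h5
    nlinarith [(Nat.cast_nonneg n : (0 : ℝ) ≤ n)]
  have hF : (0 : ℝ) < l.factorial := by positivity
  have h6 : ((l : ℝ) ^ l) ^ 2 ≤ (Real.exp 1 ^ l * l.factorial) ^ 2 := by gcongr
  have h7 : ((n : ℝ) * Real.exp 1 ^ 2) ^ l ≤ (0.99 * l ^ 2) ^ l := by gcongr
  rw [div_le_iff₀ hF]
  refine h1.trans ?_
  rw [div_le_iff₀ hF]
  have h8 : (0 : ℝ) < Real.exp 1 ^ (2 * l) := by positivity
  refine le_of_mul_le_mul_right ?_ h8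
  calc (n : ℝ) ^ l * Real.exp 1 ^ (2 * l) = ((n : ℝ) * Real.exp 1 ^ 2) ^ l := by
        rw [mul_pow, ← pow_mul]
    _ ≤ (0.99 * l ^ 2) ^ l := h7
    _ = 0.99 ^ l * ((l : ℝ) ^ l) ^ 2 := by rw [mul_pow]; ring
    _ ≤ 0.99 ^ l * (Real.exp 1 ^ l * l.factorial) ^ 2 := by gcongr
    _ = _ := by ring

lemma tendsto_pr_length :
    Tendsto (fun n : ℕ => pr n (fun f => ∃ i : ℕ, 2.8 * √n ≤ i ∧ f i ≠ 0)) atTop (𝓝 0) := by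
  refine tendsto_pr_zero_of_le tendsto_error (Eventually.of_forall fun n => ?_)
  refine (pr_mono (Q := fun f => ∃ l ∈ range (n + 1), 2.8 * √n < l ∧ ∀ i, 0 < f i ↔ i < l)
    ?_).trans ?_
  · rintro f hf ⟨i, hi, hi0⟩
    obtain ⟨l, hl, hfl⟩ := hf.exists_length
    refine ⟨l, by simp; omega, ?_, hfl⟩
    have := (hfl i).1 (Nat.pos_of_ne_zero hi0)
    exact hi.trans_lt (by exact_mod_cast this)
  · refine (pr_exists_le _ _).trans ?_
    have hb : ∀ l ∈ range (n + 1), pr n (fun f => 2.8 * √n < l ∧ ∀ i, 0 < f i ↔ i < l)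
        ≤ Real.exp (-(0.02 * √n)) := by
      intro l hl
      by_cases hc : 2.8 * √n < l
      · refine (pr_mono (Q := fun f => ∀ i, 0 < f i ↔ i < l) (fun f _ h => h.2)).trans ?_
        refine (pr_length_le n l (by simp at hl; omega)).trans ?_
        refine (choose_div_factorial_le hc).trans ?_
        have := pow_le_exp_of_le (l := l) (s := 2 * √n) (by
          have := Real.sqrt_nonneg (n : ℝ); linarith)
        refine this.trans (le_of_eq ?_)
        congr 1; ring
      · simp only [hc, false_and]
        rw [pr_false]
        positivity
    refine (sum_le_card_nsmul _ _ _ hb).trans ?_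
    rw [card_range, nsmul_eq_mul]
    gcongr
    push_cast
    have : (0 : ℝ) ≤ n := Nat.cast_nonneg n
    exact le_self_pow₀ (by linarith) (by norm_num)

lemma base_poly_bound {y : ℝ} (h0 : 0 ≤ y) (h1 : y ≤ 0.27) {x : ℝ}
    (hx : x = (2.82 * y - 2 * y ^ 2) / 2 + (2.82 * y - 2 * y ^ 2) ^ 2 / 6) :
    7.48 ≤ (2.82 - 2 * y) ^ 2 * (1 + x + x ^ 2 / 2) := by
  subst hx
  have hz : 0 ≤ 0.27 - y := by linarith
  have hb : ∀ i j : ℕ, 0 ≤ y ^ i * (0.27 - y) ^ j := fun i j => by positivity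
  linarith [hb 0 10, hb 1 9, hb 2 8, hb 3 7, hb 4 6, hb 5 5, hb 6 4, hb 7 3, hb 8 2, hb 9 1,
    hb 10 0]

lemma rows_term_le {n r S : ℕ} (hn : 1000 ≤ n) (hr : 1 ≤ r) (hrs : r ≤ 0.27 * √n)
    (hS : r * (2.82 * √n - 2 * r) < S) (hSn : S ≤ n) :
    (n.choose S : ℝ) * r ^ (2 * S) / S.factorial ≤ 0.99 ^ S := by
  have hn' : (1000 : ℝ) ≤ n := by exact_mod_cast hn
  have hr' : (1 : ℝ) ≤ r := by exact_mod_cast hr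
  set s := √(n : ℝ) with hs
  have hs2 : s ^ 2 = n := Real.sq_sqrt (by linarith)
  have hs0 : 0 < s := Real.sqrt_pos.2 (by linarith)
  set y := (r : ℝ) / s with hy
  have hry : (r : ℝ) = y * s := by rw [hy]; field_simp
  have hy0 : 0 ≤ y := by positivity
  have hy1 : y ≤ 0.27 := by rw [hy, div_le_iff₀ hs0]; exact hrs
  set t := (S : ℝ) / n with ht
  have hSt : (S : ℝ) = t * n := by rw [ht]; field_simp
  have ht1 : t ≤ 1 := by
    rw [ht, div_le_one (by linarith)]; exact_mod_cast hSn
  set σ := 2.82 * y - 2 * y ^ 2 with hσ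
  have hσ0 : 0 ≤ σ := by rw [hσ]; nlinarith
  have hσt : σ ≤ t := by
    rw [ht, le_div_iff₀ (by linarith), ← hs2]
    rw [hry] at hS
    nlinarith
  set x := σ / 2 + σ ^ 2 / 6 with hx
  have hx0 : 0 ≤ x := by positivity
  have hpoly := base_poly_bound hy0 hy1 hx
  set E := ((S : ℝ) - 1) / (2 * n) + ((S : ℝ) - 1) * (2 * S - 1) / (12 * n ^ 2) with hE
  have hEx : x - 1 / n ≤ E := by
    have h1 : E = t / 2 + t ^ 2 / 6 - (1 / n) / 2 - t * (1 / n) / 4 + (1 / n) ^ 2 / 12 := by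
      rw [hE, hSt]; field_simp; ring
    have h2 : x ≤ t / 2 + t ^ 2 / 6 := by rw [hx]; gcongr
    have h3 : 0 ≤ 1 / (n : ℝ) := by positivity
    have h4 : t * (1 / (n : ℝ)) ≤ 1 / n := mul_le_of_le_one_left h3 ht1
    rw [h1]
    nlinarith
  have hexp : (1 + x + x ^ 2 / 2) * 0.999 ≤ Real.exp E := by
    have h1 : 1 + x + x ^ 2 / 2 ≤ Real.exp x := Real.quadratic_le_exp_of_nonneg hx0
    have h2 : 0.999 ≤ Real.exp (-(1 / n)) := by
      have h3 := Real.add_one_le_exp (-(1 / (n : ℝ)))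
      have h4 : 1 / (n : ℝ) ≤ 1 / 1000 := by gcongr
      linarith
    calc _ ≤ Real.exp x * Real.exp (-(1 / n)) := by gcongr
      _ = Real.exp (x - 1 / n) := by rw [← Real.exp_add]; rfl
      _ ≤ _ := Real.exp_le_exp.2 hEx
  have hbase : (n : ℝ) * r ^ 2 * Real.exp 1 ^ 2 ≤ 0.99 * S ^ 2 * Real.exp E := by
    have h1 : ((2.82 - 2 * y) * (r * s)) ^ 2 ≤ (S : ℝ) ^ 2 := by
      have h2 : (2.82 - 2 * y) * (r * s) = r * (2.82 * s - 2 * r) := by rw [hry]; ring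
      rw [h2]
      have : 0 ≤ r * (2.82 * s - 2 * r) := mul_nonneg (by linarith) (by linarith)
      gcongr
    have h3 : Real.exp 1 ^ 2 ≤ 0.99 * (2.82 - 2 * y) ^ 2 * Real.exp E := by
      have := exp_one_sq_lt
      have h4 : (2.82 - 2 * y) ^ 2 * ((1 + x + x ^ 2 / 2) * 0.999)
        ≤ (2.82 - 2 * y) ^ 2 * Real.exp E := by gcongr
      nlinarith
    calc (n : ℝ) * r ^ 2 * Real.exp 1 ^ 2
        ≤ n * r ^ 2 * (0.99 * (2.82 - 2 * y) ^ 2 * Real.exp E) := by gcongr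
      _ = 0.99 * ((2.82 - 2 * y) * (r * s)) ^ 2 * Real.exp E := by rw [← hs2]; ring
      _ ≤ _ := by gcongr
  have hF : (0 : ℝ) < S.factorial := by positivity
  have hdesc := descFactorial_le_exp n S (by omega) hSn
  rw [← hE] at hdesc
  have hch : (n.choose S : ℝ) * S.factorial = n.descFactorial S := by
    rw [Nat.descFactorial_eq_factorial_mul_choose]; push_cast; ring
  have hfac := pow_self_le_exp_mul_factorial S
  rw [div_le_iff₀ hF]
  have hK : (0 : ℝ) < S.factorial * Real.exp (S * E) * Real.exp 1 ^ (2 * S) := by positivity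
  refine le_of_mul_le_mul_right ?_ hK
  calc (n.choose S : ℝ) * r ^ (2 * S) * (S.factorial * Real.exp (S * E) * Real.exp 1 ^ (2 * S))
      = n.descFactorial S * (r ^ (2 * S) * Real.exp (S * E) * Real.exp 1 ^ (2 * S)) := by
        rw [← hch]; ring
    _ ≤ (n ^ S * Real.exp (-(S * E))) *
        (r ^ (2 * S) * Real.exp (S * E) * Real.exp 1 ^ (2 * S)) := by
        gcongr
    _ = ((n : ℝ) * r ^ 2 * Real.exp 1 ^ 2) ^ S * (Real.exp (-(S * E)) * Real.exp (S * E)) := by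
        rw [mul_pow, mul_pow, ← pow_mul, ← pow_mul]; ring
    _ = ((n : ℝ) * r ^ 2 * Real.exp 1 ^ 2) ^ S := by rw [← Real.exp_add]; simp
    _ ≤ (0.99 * S ^ 2 * Real.exp E) ^ S := by gcongr
    _ = 0.99 ^ S * ((S : ℝ) ^ S) ^ 2 * Real.exp (S * E) := by
        rw [mul_pow, mul_pow, Real.exp_nat_mul]; ring
    _ ≤ 0.99 ^ S * (Real.exp 1 ^ S * S.factorial) ^ 2 * Real.exp (S * E) := by gcongr
    _ = _ := by ring

lemma tendsto_pr_rows :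
    Tendsto (fun n : ℕ => pr n (fun f => ∃ r : ℕ, 1 ≤ r ∧ r ≤ 0.27 * √n ∧
      r * (2.82 * √n - 2 * r) < (∑ i ∈ range r, f i : ℕ))) atTop (𝓝 0) := by
  refine tendsto_pr_zero_of_le tendsto_error ?_
  have hev := (tendsto_order.1 tendsto_error).2 1 one_pos
  filter_upwards [hev, eventually_ge_atTop 1000] with n hlt hn
  have hn' : (1000 : ℝ) ≤ n := by exact_mod_cast hn
  have hs2 : √(n : ℝ) ^ 2 = n := Real.sq_sqrt (by linarith)
  have hs0 : 0 < √(n : ℝ) := Real.sqrt_pos.2 (by linarith)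
  refine (pr_mono (Q := fun f => ∃ p ∈ range (n + 1) ×ˢ range (n + 1),
    (1 ≤ p.1 ∧ p.1 ≤ 0.27 * √n ∧ p.1 * (2.82 * √n - 2 * p.1) < p.2) ∧
      ∑ i ∈ range p.1, f i = p.2) ?_).trans ?_
  · rintro f hf ⟨r, h1, h2, h3⟩
    refine ⟨(r, ∑ i ∈ range r, f i), ?_, ⟨h1, h2, h3⟩, rfl⟩
    simp only [mem_product, mem_range, Order.lt_add_one_iff]
    refine ⟨?_, hf.sum_le r⟩
    have : (r : ℝ) ≤ n := by nlinarith
    exact_mod_cast this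
  · refine (pr_exists_le _ _).trans ?_
    have hb : ∀ p ∈ range (n + 1) ×ˢ range (n + 1), pr n (fun f =>
        (1 ≤ p.1 ∧ p.1 ≤ 0.27 * √n ∧ p.1 * (2.82 * √n - 2 * p.1) < p.2) ∧
          ∑ i ∈ range p.1, f i = p.2) ≤ (n + 1) * Real.exp (-(0.02 * √n)) := by
      rintro ⟨r, S⟩ hp
      simp only [mem_product, mem_range, Order.lt_add_one_iff] at hp
      by_cases hc : 1 ≤ r ∧ (r : ℝ) ≤ 0.27 * √n ∧ r * (2.82 * √n - 2 * r) < (S : ℝ)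
      · have hr' : (1 : ℝ) ≤ r := by exact_mod_cast hc.1
        refine (pr_mono (Q := fun f => ∑ i ∈ range r, f i = S) (fun f _ h => h.2)).trans ?_
        refine (pr_rows_le n r S hp.2).trans ?_
        have h1 := rows_term_le hn hc.1 hc.2.1 hc.2.2 hp.2
        have h2 := pow_le_exp_of_le (l := S) (s := 2 * r * √n) (by nlinarith [hc.2.1, hc.2.2])
        have h3 : Real.exp (-(0.01 * (2 * r * √n))) = Real.exp (-(0.02 * √n)) ^ r := by
          rw [← Real.exp_nat_mul]; congr 1; ring
        have h4 : ((n : ℝ) + 1) * Real.exp (-(0.02 * √n)) ≤ 1 := by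
          refine le_trans ?_ hlt.le
          gcongr
          exact le_self_pow₀ (by linarith) (by norm_num)
        calc _ = ((n : ℝ) + 1) ^ r * (n.choose S * r ^ (2 * S) / S.factorial) := by ring
          _ ≤ ((n : ℝ) + 1) ^ r * Real.exp (-(0.02 * √n)) ^ r := by
              gcongr
              exact (h1.trans h2).trans h3.le
          _ = (((n : ℝ) + 1) * Real.exp (-(0.02 * √n))) ^ r := by rw [mul_pow]
          _ ≤ _ := pow_le_of_le_one (by positivity) h4 (by omega)
      · simp only [hc, false_and]
        rw [pr_false]
        positivity
    refine (sum_le_card_nsmul _ _ _ hb).trans (le_of_eq ?_)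
    rw [card_product, card_range, nsmul_eq_mul]
    push_cast
    ring

end

/-! ### Partial sums of rows in the middle range -/

section

open Finset Filter Topology

variable {n : ℕ} {f : ℕ → ℕ}

lemma two_mul_sum_mul_add_sum_le {f : ℕ → ℕ} (hf : Antitone f) (r : ℕ) :
    2 * ∑ i ∈ range r, i * f i + ∑ i ∈ range r, f i ≤ r * ∑ i ∈ range r, f i := by
  induction r with
  | zero => simp
  | succ r ih =>
    have h : r * f r ≤ ∑ i ∈ range r, f i := by
      have := card_nsmul_le_sum (range r) f (f r) (fun i hi => hf (by simp at hi; omega))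
      simpa using this
    rw [sum_range_succ, sum_range_succ]
    nlinarith

lemma sq_sum_le_card_mul {r : ℕ} (f : ℕ → ℕ) :
    (∑ i ∈ range r, (f i : ℝ)) ^ 2 ≤ r * ∑ i ∈ range r, (f i : ℝ) ^ 2 := by
  simpa using sq_sum_le_card_mul_sum_sq (s := range r) (f := fun i => (f i : ℝ))

/-- A lower bound for the content sum in terms of the first `r` rows and the length `N`. -/
lemma IsPart.le_twoContent (h : IsPart n f) {r N : ℕ} (hr : 0 < r) (hrN : r ≤ N)
    (hN : ∀ i, N ≤ i → f i = 0) {S : ℕ} (hS : ∑ i ∈ range r, f i = S) :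
    (S : ℝ) ^ 2 / r - n - ((r - 1) * S + (N + r - 1) * (n - S)) ≤ twoContent f := by
  obtain ⟨M, rfl⟩ := Nat.exists_eq_add_of_le hrN
  have hr' : (0 : ℝ) < r := by exact_mod_cast hr
  have hsum : ∑ j ∈ range M, f (r + j) + S = n := by
    have h1 := h.psize_eq
    rw [psize_eq_sum hN, sum_range_add, hS] at h1
    omega
  have h1 := two_mul_sum_mul_add_sum_le h.anti r
  have h2 := two_mul_sum_mul_add_sum_le (f := fun j => f (r + j))
    (fun a b hab => h.anti (by omega)) M
  rw [hS] at h1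
  set S' := ∑ j ∈ range M, f (r + j) with hS'
  have h1' : 2 * ∑ i ∈ range r, (i : ℝ) * f i + S ≤ r * S := by exact_mod_cast h1
  have h2' : 2 * ∑ i ∈ range M, (i : ℝ) * f (r + i) + S' ≤ M * S' := by exact_mod_cast h2
  have hsum' : (S' : ℝ) + S = n := by exact_mod_cast hsum
  have h3 := sq_sum_le_card_mul (r := r) f
  have hS2 : ∑ i ∈ range r, (f i : ℝ) = S := by exact_mod_cast hS
  rw [hS2] at h3
  have h3' : (S : ℝ) ^ 2 / r ≤ ∑ i ∈ range r, (f i : ℝ) ^ 2 := by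
    rw [div_le_iff₀ hr']; linarith
  have h4 : (0 : ℝ) ≤ ∑ j ∈ range M, (f (r + j) : ℝ) ^ 2 := by positivity
  have e1 : ∑ i ∈ range r, ((f i : ℝ) * (f i - 1) - 2 * i * f i)
      = ∑ i ∈ range r, (f i : ℝ) ^ 2 - S - 2 * ∑ i ∈ range r, (i : ℝ) * f i := by
    rw [← hS2, mul_sum, ← sum_sub_distrib, ← sum_sub_distrib]
    exact sum_congr rfl fun i _ => by ring
  have e2 : ∑ i ∈ range M, ((f (r + i) : ℝ) * (f (r + i) - 1) - 2 * (r + i : ℕ) * f (r + i))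
      = ∑ i ∈ range M, (f (r + i) : ℝ) ^ 2 - S' - 2 * r * S'
        - 2 * ∑ i ∈ range M, (i : ℝ) * f (r + i) := by
    rw [hS']
    push_cast
    rw [mul_sum, mul_sum, ← sum_sub_distrib, ← sum_sub_distrib, ← sum_sub_distrib]
    exact sum_congr rfl fun i _ => by ring
  rw [h.twoContent_eq hN, sum_range_add, e1, e2]
  push_cast
  nlinarith

set_option maxHeartbeats 800000 in
lemma rows_middle (h : IsPart n f) (hn : 10000 ≤ n) (hlen : ∀ i : ℕ, 2.8 * √n ≤ i → f i = 0)
    (hX : twoContent f ≤ n * √n / 50) {r : ℕ} (h1 : 0.27 * √n ≤ r) (h2 : r ≤ 0.71 * √n) :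
    (∑ i ∈ range r, f i : ℕ) ≤ r * (2.82 * √n - 2 * r) := by
  have hn' : (10000 : ℝ) ≤ n := by exact_mod_cast hn
  set s := √(n : ℝ) with hs
  have hs2 : s ^ 2 = n := Real.sq_sqrt (by linarith)
  have hs0 : 100 ≤ s := by
    rw [hs]; apply Real.le_sqrt_of_sq_le; linarith
  set N := ⌈2.8 * s⌉₊ with hNdef
  have hN1 : 2.8 * s ≤ N := Nat.le_ceil _
  have hN2 : (N : ℝ) < 2.8 * s + 1 := Nat.ceil_lt_add_one (by linarith)
  have hN : ∀ i, N ≤ i → f i = 0 := fun i hi =>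
    hlen i (hN1.trans (by exact_mod_cast hi))
  have hr0 : (0 : ℝ) < r := by linarith
  have hrN : r ≤ N := by
    have : (r : ℝ) ≤ N := by linarith
    exact_mod_cast this
  by_contra! hcon
  set S := ∑ i ∈ range r, f i with hS
  have key := h.le_twoContent (by exact_mod_cast hr0) hrN hN hS.symm
  have hSn : (S : ℝ) ≤ n := by exact_mod_cast h.sum_le r
  set y := (r : ℝ) / s with hy
  have hry : (r : ℝ) = y * s := by rw [hy]; field_simp
  have hy0 : 0.27 ≤ y := by rw [hy, le_div_iff₀ (by linarith)]; exact h1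
  have hy1 : y ≤ 0.71 := by rw [hy, div_le_iff₀ (by linarith)]; exact h2
  set σ := (S : ℝ) / n with hσ
  have hSσ : (S : ℝ) = σ * s ^ 2 := by rw [hs2, hσ]; field_simp
  have hσ1 : σ ≤ 1 := by rw [hσ, div_le_one (by linarith)]; exact hSn
  have hσ2 : y * (2.82 - 2 * y) ≤ σ := by
    rw [hry, hSσ] at hcon
    have : y * (2.82 - 2 * y) * s ^ 2 ≤ σ * s ^ 2 := by nlinarith
    exact le_of_mul_le_mul_right this (by positivity)
  have k1 : (S : ℝ) ^ 2 / r = σ ^ 2 / y * s ^ 3 := by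
    rw [hry, hSσ]; field_simp
  have hyp : 0 < y := by linarith
  have k2 : y * (2.82 - 2 * y) ^ 2 ≤ σ ^ 2 / y := by
    rw [le_div_iff₀ hyp]
    calc y * (2.82 - 2 * y) ^ 2 * y = (y * (2.82 - 2 * y)) ^ 2 := by ring
      _ ≤ σ ^ 2 := by
        have : 0 ≤ y * (2.82 - 2 * y) := mul_nonneg hyp.le (by linarith)
        gcongr
  have hns : 0 ≤ (n : ℝ) - S := by linarith
  have k3 : (N + r - 1) * ((n : ℝ) - S) ≤ (2.8 * s + r) * (n - S) := by
    gcongr; linarith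
  have k4 : (r - 1) * (S : ℝ) ≤ r * S := by nlinarith [(Nat.cast_nonneg S : (0 : ℝ) ≤ S)]
  have k5 : σ ^ 2 / y * s ^ 3 - s ^ 2 - (y * s * (σ * s ^ 2) +
        (2.8 * s + y * s) * (s ^ 2 - σ * s ^ 2))
      ≤ s ^ 3 / 50 := by
    rw [k1] at key
    rw [← hSσ, ← hry, hs2]
    calc _ ≤ twoContent f := by linarith
      _ ≤ _ := hX
      _ = _ := by rw [← hs2]; ring
  have k6 : (σ ^ 2 / y + 2.8 * σ - 2.8 - y - 0.02) * s ^ 3 ≤ s ^ 2 := by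
    linarith
  have k7 : 0.03 ≤ σ ^ 2 / y + 2.8 * σ - 2.8 - y - 0.02 := by
    have : 0.03 ≤ y * (2.82 - 2 * y) ^ 2 + 2.8 * (y * (2.82 - 2 * y)) - 2.8 - y - 0.02 := by
      nlinarith [mul_nonneg (sub_nonneg.2 hy0) (sub_nonneg.2 hy1),
        mul_nonneg (mul_nonneg (sub_nonneg.2 hy0) (sub_nonneg.2 hy1)) (sub_nonneg.2 hy1)]
    linarith
  have k8 : 0.03 * s ^ 3 ≤ s ^ 2 :=
    le_trans (mul_le_mul_of_nonneg_right k7 (by positivity)) k6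
  nlinarith [mul_le_mul_of_nonneg_right hs0 (sq_nonneg s)]

end

/-! ### Distances between elements of a finite set -/

section

open Finset Filter Topology

/-- The number of pairs at distance `δ` in a finite set. -/
def prs (D : Finset ℕ) (δ : ℕ) : ℕ := #{x ∈ D | x + δ ∈ D}

lemma prs_mono {D D' : Finset ℕ} (h : D ⊆ D') (δ : ℕ) : prs D δ ≤ prs D' δ := by
  apply card_le_card
  intro x
  simp only [mem_filter]
  exact fun hx => ⟨h hx.1, h hx.2⟩

lemma prs_le_erase (D : Finset ℕ) (i δ : ℕ) : prs D δ ≤ prs (D.erase i) δ + 2 := by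
  unfold prs
  have : {x ∈ D | x + δ ∈ D} ⊆ insert i (insert (i - δ) {x ∈ D.erase i | x + δ ∈ D.erase i}) := by
    intro x
    simp only [mem_filter, mem_insert, mem_erase]
    intro hx
    by_cases h1 : x = i
    · exact Or.inl h1
    by_cases h2 : x + δ = i
    · right; left; omega
    · tauto
  refine (card_le_card this).trans ?_
  exact (card_insert_le _ _).trans (Nat.succ_le_succ (card_insert_le _ _))

lemma prs_le_erase_of_not_mem {D : Finset ℕ} {i δ : ℕ} (h1 : i + δ ∉ D)
    (h2 : ¬ (δ ≤ i ∧ i - δ ∈ D)) : prs D δ ≤ prs (D.erase i) δ := by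
  apply card_le_card
  intro x
  simp only [mem_filter, mem_erase]
  rintro ⟨hx, hxδ⟩
  refine ⟨⟨?_, hx⟩, ?_, hxδ⟩
  · rintro rfl; exact h1 hxδ
  · rintro rfl
    exact h2 ⟨by omega, by simpa using hx⟩

/-- A truncated count of pairs at distance at most `B`. -/
def pot (B M : ℕ) (D : Finset ℕ) : ℕ := ∑ δ ∈ Icc 1 B, min (prs D δ) M

/-- The elements involved in a pair whose distance occurs only few times. -/
def rare (B M : ℕ) (D : Finset ℕ) : Finset ℕ :=
  {i ∈ D | ∃ δ ∈ Icc 1 B, prs D δ < M + 2 ∧ (i + δ ∈ D ∨ (δ ≤ i ∧ i - δ ∈ D))}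

lemma card_rare_le (B M : ℕ) (D : Finset ℕ) : #(rare B M D) ≤ B * (2 * (M + 1)) := by
  have hsub : rare B M D ⊆ ({δ ∈ Icc 1 B | prs D δ < M + 2}).biUnion fun δ =>
      {x ∈ D | x + δ ∈ D} ∪ ({x ∈ D | x + δ ∈ D}).image (· + δ) := by
    intro i
    simp only [rare, mem_filter, mem_biUnion, mem_union, mem_image]
    rintro ⟨hi, δ, hδ, hlt, h | h⟩
    · exact ⟨δ, ⟨hδ, hlt⟩, Or.inl ⟨hi, h⟩⟩
    · exact ⟨δ, ⟨hδ, hlt⟩, Or.inr ⟨i - δ, ⟨h.2, by rwa [Nat.sub_add_cancel h.1]⟩, by omega⟩⟩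
  refine (card_le_card hsub).trans (card_biUnion_le.trans ?_)
  have h1 : ∀ δ ∈ ({δ ∈ Icc 1 B | prs D δ < M + 2}),
      #({x ∈ D | x + δ ∈ D} ∪ ({x ∈ D | x + δ ∈ D}).image (· + δ)) ≤ 2 * (M + 1) := by
    intro δ hδ
    have h2 : prs D δ < M + 2 := (mem_filter.1 hδ).2
    have h3 := card_union_le {x ∈ D | x + δ ∈ D} (({x ∈ D | x + δ ∈ D}).image (· + δ))
    have h4 := card_image_le (s := {x ∈ D | x + δ ∈ D}) (f := (· + δ))
    unfold prs at h2
    omega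
  refine (sum_le_card_nsmul _ _ _ h1).trans ?_
  rw [smul_eq_mul]
  gcongr
  exact (card_filter_le _ _).trans (by simp)

variable {B M i : ℕ} {D D' : Finset ℕ}

lemma pot_le_add (h : D.erase i ⊆ D') : pot B M D ≤ pot B M D' + 2 * B := by
  have h1 : ∀ δ ∈ Icc 1 B, min (prs D δ) M ≤ min (prs D' δ) M + 2 := by
    intro δ _
    have h2 := prs_le_erase D i δ
    have h3 := prs_mono h δ
    omega
  refine (sum_le_sum h1).trans ?_
  rw [sum_add_distrib]
  simp only [sum_const, Nat.card_Icc, smul_eq_mul, pot]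
  omega

lemma min_prs_le_of_not_mem_rare (hi : i ∉ rare B M D) (hiD : i ∈ D) (h : D.erase i ⊆ D')
    {δ : ℕ} (hδ : δ ∈ Icc 1 B) : min (prs D δ) M ≤ min (prs D' δ) M := by
  have h2 := prs_le_erase D i δ
  have h3 := prs_mono h δ
  by_cases h4 : prs D δ < M + 2
  · have h5 : ¬ (i + δ ∈ D ∨ (δ ≤ i ∧ i - δ ∈ D)) := fun h5 =>
      hi (mem_filter.2 ⟨hiD, δ, hδ, h4, h5⟩)
    have h6 := prs_le_erase_of_not_mem (fun h7 => h5 (Or.inl h7)) (fun h7 => h5 (Or.inr h7))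
    omega
  · omega

lemma pot_le_of_not_mem_rare (hi : i ∉ rare B M D) (hiD : i ∈ D) (h : D.erase i ⊆ D') :
    pot B M D ≤ pot B M D' :=
  sum_le_sum fun _ hδ => min_prs_le_of_not_mem_rare hi hiD h hδ

/-- No two consecutive distances (below `B`) both occur at least `M` times. -/
def Poor (B M : ℕ) (D : Finset ℕ) : Prop :=
  ∀ δ < B, ¬ ((δ = 0 ∨ M ≤ prs D δ) ∧ M ≤ prs D (δ + 1))

lemma pot_lt_of_poor (hB : 1 ≤ B) (hbad : Poor B M D) (hi : i ∉ rare B M D) (hiD : i ∈ D)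
    (hi0 : 1 ≤ i) {δ : ℕ} (hδ : 1 ≤ δ) (hδB : δ < B) (hiδ : i + δ ∈ D)
    (h : D.erase i ⊆ D') (hi' : i - 1 ∈ D') : pot B M D + 1 ≤ pot B M D' := by
  have hr : ∀ ε ∈ Icc 1 B, prs D ε < M + 2 → ¬ (i + ε ∈ D ∨ (ε ≤ i ∧ i - ε ∈ D)) :=
    fun ε hε h4 h5 => hi (mem_filter.2 ⟨hiD, ε, hε, h4, h5⟩)
  have h1 : prs D 1 < M := by
    have := hbad 0 (by omega)
    simp at this
    exact this
  have him : i - 1 ∉ D := fun h2 =>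
    hr 1 (by simp; omega) (by omega) (Or.inr ⟨hi0, h2⟩)
  have h2 : M + 2 ≤ prs D δ := by
    by_contra h3
    exact hr δ (by simp; omega) (by omega) (Or.inl hiδ)
  have h3 : prs D (δ + 1) < M := by
    have := hbad δ hδB
    by_contra h4
    exact this ⟨Or.inr (by omega), by omega⟩
  have hmem : δ + 1 ∈ Icc 1 B := by simp; omega
  have h4 := hr (δ + 1) hmem (by omega)
  have h5 : prs D (δ + 1) + 1 ≤ prs D' (δ + 1) := by
    have hsub : insert (i - 1) {x ∈ D | x + (δ + 1) ∈ D} ⊆ {x ∈ D' | x + (δ + 1) ∈ D'} := by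
      intro x
      simp only [mem_insert, mem_filter]
      rintro (rfl | ⟨hx1, hx2⟩)
      · refine ⟨hi', h (mem_erase.2 ⟨by omega, ?_⟩)⟩
        rwa [show i - 1 + (δ + 1) = i + δ by omega]
      · refine ⟨h (mem_erase.2 ⟨?_, hx1⟩), h (mem_erase.2 ⟨?_, hx2⟩)⟩
        · rintro rfl; exact h4 (Or.inl hx2)
        · rintro rfl; exact h4 (Or.inr ⟨by omega, by simpa using hx1⟩)
    have := card_le_card hsub
    rwa [card_insert_of_notMem (by simp [him])] at this
  unfold pot
  rw [← add_sum_erase _ _ hmem, ← add_sum_erase _ _ hmem]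
  have h6 : ∑ x ∈ (Icc 1 B).erase (δ + 1), min (prs D x) M
      ≤ ∑ x ∈ (Icc 1 B).erase (δ + 1), min (prs D' x) M :=
    sum_le_sum fun x hx => min_prs_le_of_not_mem_rare hi hiD h (mem_of_mem_erase hx)
  omega

/-- The elements of a finite set with no other element shortly above them. -/
def isol (B : ℕ) (D : Finset ℕ) : Finset ℕ := {i ∈ D | ∀ δ, 1 ≤ δ → δ < B → i + δ ∉ D}

/-- A set of naturals with gaps at least `b` and small sum is small. -/
lemma card_le_of_separated {I : Finset ℕ} {b n t : ℕ} (hb : 0 < b) (ht : 0 < t)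
    (hsep : ∀ x ∈ I, ∀ y ∈ I, x < y → x + b ≤ y) (hsum : ∑ x ∈ I, x ≤ n) :
    (#I : ℝ) ≤ t + n / (t * b) := by
  have h1 : #{x ∈ I | x < t * b} ≤ t := by
    refine (card_le_card_of_injOn (t := range t) (fun x => x / b) ?_ ?_).trans (card_range t).le
    · intro x hx
      simp only [coe_filter, Set.mem_ofPred_eq] at hx
      simp only [coe_range, Set.mem_Iio]
      exact (Nat.div_lt_iff_lt_mul hb).2 hx.2
    · intro x hx y hy hxy
      simp only [coe_filter, Set.mem_ofPred_eq] at hx hy hxy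
      by_contra hne
      rcases Nat.lt_or_gt_of_ne hne with h | h
      · have := Nat.div_le_div_right (c := b) (hsep x hx.1 y hy.1 h)
        rw [Nat.add_div_right _ hb] at this
        omega
      · have := Nat.div_le_div_right (c := b) (hsep y hy.1 x hx.1 h)
        rw [Nat.add_div_right _ hb] at this
        omega
  have h2 : #{x ∈ I | ¬ x < t * b} * (t * b) ≤ n := by
    have := card_nsmul_le_sum ({x ∈ I | ¬ x < t * b}) (fun x => x) (t * b)
      (fun x hx => by simp at hx; exact hx.2)
    refine (by simpa using this : _ ≤ _).trans ?_
    exact (sum_le_sum_of_subset (filter_subset _ _)).trans hsum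
  have h3 := card_filter_add_card_filter_not (s := I) (fun x => x < t * b)
  have h4 : (#{x ∈ I | ¬ x < t * b} : ℝ) ≤ n / (t * b) := by
    rw [le_div_iff₀ (by positivity)]
    exact_mod_cast h2
  have h5 : (#I : ℝ) = #{x ∈ I | x < t * b} + #{x ∈ I | ¬ x < t * b} := by exact_mod_cast h3.symm
  have h1' : (#{x ∈ I | x < t * b} : ℝ) ≤ t := by exact_mod_cast h1
  linarith

lemma IsPart.sum_cor_le {n : ℕ} {f : ℕ → ℕ} (h : IsPart n f) : ∑ x ∈ cor f, x ≤ n := by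
  have h1 : ∀ N, ∑ i ∈ range N, ((i : ℤ) + 1) * (f i - f (i + 1))
      = ∑ i ∈ range N, (f i : ℤ) - N * f N := by
    intro N
    induction N with
    | zero => simp
    | succ N ih => rw [sum_range_succ, sum_range_succ, ih]; push_cast; ring
  have h2 := h1 n
  rw [h.zero n le_rfl] at h2
  have h3 : ∑ i ∈ range n, (f i : ℤ) = n := by exact_mod_cast h.sum
  rw [h3] at h2
  simp only [Nat.cast_zero, mul_zero, sub_zero] at h2
  have h4 : ∑ x ∈ cor f, (x : ℤ) ≤ ∑ i ∈ range n, ((i : ℤ) + 1) * (f i - f (i + 1)) := by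
    have hsub : cor f ⊆ range n := by
      rw [cor, h.psize_eq]; exact filter_subset _ _
    refine (sum_le_sum ?_).trans (sum_le_sum_of_subset_of_nonneg hsub ?_)
    · intro i hi
      have := h.mem_cor.1 hi
      have h5 : (1 : ℤ) ≤ f i - f (i + 1) := by omega
      nlinarith
    · intro i _ _
      have := h.anti (Nat.le_succ i)
      have h5 : (0 : ℤ) ≤ f i - f (i + 1) := by simp only [Nat.succ_eq_add_one] at this; omega
      positivity
  have : ((∑ x ∈ cor f, x : ℕ) : ℤ) ≤ n := by push_cast; linarith
  exact_mod_cast this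

end

/-! ### Distances between corners of a random partition -/

section

open Finset Filter Topology

variable {n i : ℕ} {f : ℕ → ℕ}

lemma erase_cor_subset_cor_dn (h : IsPart (n + 1) f) (hi : i ∈ cor f) :
    (cor f).erase i ⊆ cor (dn f i) := by
  intro x hx
  rw [mem_erase, h.mem_cor] at hx
  rw [(h.dn (h.mem_cor.1 hi)).mem_cor, dn_apply, dn_apply]
  grind

lemma pred_mem_cor_dn (h : IsPart (n + 1) f) (hi : i ∈ cor f) (hi0 : 1 ≤ i) :
    i - 1 ∈ cor (dn f i) := by
  have h1 := h.mem_cor.1 hi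
  have h2 := h.anti (Nat.sub_le i 1)
  rw [(h.dn h1).mem_cor, dn_apply, dn_apply, if_pos (by omega), if_neg (by omega)]
  omega

lemma erase_cor_subset_cor_up (h : IsPart n f) (hi : i ∈ addable f) :
    (cor f).erase (i - 1) ⊆ cor (up f i) := by
  intro x hx
  rw [mem_erase, h.mem_cor] at hx
  rw [(h.up (h.mem_addable.1 hi)).mem_cor, up_apply, up_apply]
  grind

lemma cor_subset_cor_up_zero (h : IsPart n f) : cor f ⊆ cor (up f 0) := by
  intro x hx
  rw [h.mem_cor] at hx
  rw [(h.up (Or.inl rfl)).mem_cor, up_apply, up_apply]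
  grind

lemma edge_sum_le {Z : (ℕ → ℕ) → Finset ℕ} {K A : ℝ}
    (hZ : ∀ f, IsPart (n + 1) f → Z f ⊆ cor f) (hK : ∀ f, IsPart (n + 1) f → (#(Z f) : ℝ) ≤ K)
    (hA : ∀ g, IsPart n g → (#(addable g) : ℝ) ≤ A) :
    ∑ f ∈ ptns (n + 1), ∑ i ∈ Z f, dimR f * dimR (dn f i)
      ≤ (n + 1).factorial * √(K * A / (n + 1)) := by
  rw [sum_sigma']
  refine (Real.sum_mul_le_sqrt_mul_sqrt _ _ _).trans ?_
  rw [← Real.sqrt_mul (sum_nonneg fun _ _ => sq_nonneg _)]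
  have h1 : ∑ p ∈ (ptns (n + 1)).sigma Z, dimR p.1 ^ 2 ≤ K * (n + 1).factorial := by
    rw [sum_sigma, ← sum_dimR_sq, mul_sum]
    refine sum_le_sum fun f hf => ?_
    simp only [sum_const, nsmul_eq_mul]
    gcongr
    exact hK f (mem_ptns.1 hf)
  have h2 : ∑ p ∈ (ptns (n + 1)).sigma Z, dimR (dn p.1 p.2) ^ 2 ≤ A * n.factorial := by
    rw [sum_sigma]
    calc _ ≤ ∑ f ∈ ptns (n + 1), ∑ i ∈ cor f, dimR (dn f i) ^ 2 :=
          sum_le_sum fun f hf => sum_le_sum_of_subset_of_nonneg (hZ f (mem_ptns.1 hf))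
            fun _ _ _ => sq_nonneg _
      _ = ∑ g ∈ ptns n, ∑ i ∈ addable g, dimR g ^ 2 := sum_edges n fun _ _ g => dimR g ^ 2
      _ ≤ A * n.factorial := by
          rw [← sum_dimR_sq, mul_sum]
          refine sum_le_sum fun f hf => ?_
          rw [sum_const, nsmul_eq_mul]
          gcongr
          exact hA f (mem_ptns.1 hf)
  have h3 : (0 : ℝ) < (n + 1).factorial := by positivity
  have h4 := (sum_nonneg fun _ _ => sq_nonneg _).trans h1
  rw [← Real.sqrt_sq h3.le, ← Real.sqrt_mul (by positivity)]
  apply Real.sqrt_le_sqrt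
  refine (mul_le_mul h1 h2 (sum_nonneg fun _ _ => sq_nonneg _) h4).trans (le_of_eq ?_)
  rw [Nat.factorial_succ]
  push_cast
  field_simp

lemma edge_sum_up_le {Z : (ℕ → ℕ) → Finset ℕ} {K A : ℝ}
    (hZ : ∀ f, IsPart n f → Z f ⊆ addable f) (hK : ∀ f, IsPart n f → (#(Z f) : ℝ) ≤ K)
    (hA : ∀ g, IsPart (n + 1) g → (#(cor g) : ℝ) ≤ A) :
    ∑ g ∈ ptns n, ∑ i ∈ Z g, dimR (up g i) * dimR g
      ≤ (n + 1).factorial * √(K * A / (n + 1)) := by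
  rw [sum_sigma']
  refine (Real.sum_mul_le_sqrt_mul_sqrt _ _ _).trans ?_
  rw [mul_comm, ← Real.sqrt_mul (sum_nonneg fun _ _ => sq_nonneg _)]
  have h1 : ∑ p ∈ (ptns n).sigma Z, dimR p.1 ^ 2 ≤ K * n.factorial := by
    rw [sum_sigma, ← sum_dimR_sq, mul_sum]
    refine sum_le_sum fun f hf => ?_
    simp only [sum_const, nsmul_eq_mul]
    gcongr
    exact hK f (mem_ptns.1 hf)
  have h2 : ∑ p ∈ (ptns n).sigma Z, dimR (up p.1 p.2) ^ 2 ≤ A * (n + 1).factorial := by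
    rw [sum_sigma]
    calc _ ≤ ∑ g ∈ ptns n, ∑ i ∈ addable g, dimR (up g i) ^ 2 :=
          sum_le_sum fun f hf => sum_le_sum_of_subset_of_nonneg (hZ f (mem_ptns.1 hf))
            fun _ _ _ => sq_nonneg _
      _ = ∑ f ∈ ptns (n + 1), ∑ i ∈ cor f, dimR f ^ 2 :=
          (sum_edges n fun f _ _ => dimR f ^ 2).symm
      _ ≤ A * (n + 1).factorial := by
          rw [← sum_dimR_sq, mul_sum]
          refine sum_le_sum fun f hf => ?_
          rw [sum_const, nsmul_eq_mul]
          gcongr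
          exact hA f (mem_ptns.1 hf)
  have h3 : (0 : ℝ) < (n + 1).factorial := by positivity
  have h4 := (sum_nonneg fun _ _ => sq_nonneg _).trans h1
  rw [← Real.sqrt_sq h3.le, ← Real.sqrt_mul (by positivity)]
  apply Real.sqrt_le_sqrt
  refine (mul_le_mul h1 h2 (sum_nonneg fun _ _ => sq_nonneg _) h4).trans (le_of_eq ?_)
  rw [Nat.factorial_succ]
  push_cast
  field_simp

/-- The corners not contributing to the growth of `pot`. -/
def exc (B M : ℕ) (D : Finset ℕ) : Finset ℕ :=
  rare B M D ∪ isol B D ∪ {i ∈ D | i = 0}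

lemma pot_dn_ge {B M : ℕ} (hB : 1 ≤ B) (h : IsPart (n + 1) f) (hi : i ∈ cor f) (P : Prop)
    [Decidable P] (hP : P → Poor B M (cor f)) :
    (if P then 1 else 0 : ℝ) ≤ ((pot B M (cor (dn f i)) : ℝ) - pot B M (cor f))
      + (if i ∈ exc B M (cor f) then 1 else 0)
      + 2 * B * (if i ∈ rare B M (cor f) then 1 else 0) := by
  have hsub := erase_cor_subset_cor_dn h hi
  by_cases hr : i ∈ rare B M (cor f)
  · have h1 : i ∈ exc B M (cor f) := by simp [exc, hr]
    rw [if_pos h1, if_pos hr]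
    have h2 : (pot B M (cor f) : ℝ) ≤ pot B M (cor (dn f i)) + 2 * B := by
      exact_mod_cast pot_le_add (B := B) (M := M) hsub
    split_ifs <;> linarith
  · rw [if_neg hr]
    have h2 : (pot B M (cor f) : ℝ) ≤ pot B M (cor (dn f i)) := by
      exact_mod_cast pot_le_of_not_mem_rare hr hi hsub
    by_cases h1 : i ∈ exc B M (cor f)
    · rw [if_pos h1]
      split_ifs <;> linarith
    · rw [if_neg h1]
      by_cases hp : P
      · rw [if_pos hp]
        simp only [exc, mem_union, mem_filter, not_or, isol, not_and] at h1
        have h3 := h1.1.2 hi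
        push Not at h3
        obtain ⟨δ, hδ1, hδB, hδ⟩ := h3
        have := pot_lt_of_poor hB (hP hp) hr hi (Nat.one_le_iff_ne_zero.2 (h1.2 hi)) hδ1 hδB hδ hsub
          (pred_mem_cor_dn h hi (Nat.one_le_iff_ne_zero.2 (h1.2 hi)))
        have : (pot B M (cor f) : ℝ) + 1 ≤ pot B M (cor (dn f i)) := by exact_mod_cast this
        linarith
      · rw [if_neg hp]
        linarith

lemma pot_up_ge {B M : ℕ} (h : IsPart n f) (hi : i ∈ addable f) :
    (pot B M (cor f) : ℝ) - pot B M (cor (up f i))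
      ≤ 2 * B * (if i ∈ (rare B M (cor f)).image (· + 1) then 1 else 0) := by
  have hsub := erase_cor_subset_cor_up h hi
  split_ifs with hr
  · have h2 : (pot B M (cor f) : ℝ) ≤ pot B M (cor (up f i)) + 2 * B := by
      exact_mod_cast pot_le_add (B := B) (M := M) hsub
    linarith
  · suffices h2 : pot B M (cor f) ≤ pot B M (cor (up f i)) by
      have : (pot B M (cor f) : ℝ) ≤ pot B M (cor (up f i)) := by exact_mod_cast h2
      linarith
    rw [addable, mem_insert, mem_image] at hi
    rcases hi with rfl | ⟨a, ha, rfl⟩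
    · exact sum_le_sum fun δ _ => min_le_min (prs_mono (cor_subset_cor_up_zero h) δ) le_rfl
    · refine pot_le_of_not_mem_rare (i := a) ?_ ha (by simpa using hsub)
      intro hra
      exact hr (mem_image_of_mem _ hra)

/-- The Plancherel mass of partitions with a poor corner set. -/
lemma sum_poor_le {B M : ℕ} (hB : 1 ≤ B) {K₁ K₂ A : ℝ}
    (hK₁ : ∀ f, IsPart (n + 1) f → (#(exc B M (cor f)) : ℝ) ≤ K₁)
    (hK₂ : ∀ D, (#(rare B M D) : ℝ) ≤ K₂)
    (hA₁ : ∀ g, IsPart n g → (#(addable g) : ℝ) ≤ A)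
    (hA₂ : ∀ g, IsPart (n + 1) g → (#(cor g) : ℝ) ≤ A) :
    pr (n + 1) (fun f => Poor B M (cor f))
      ≤ √(K₁ * A / (n + 1)) + 4 * B * √(K₂ * A / (n + 1)) := by
  classical
  have h3 : (0 : ℝ) < (n + 1).factorial := by positivity
  rw [pr_eq, div_le_iff₀ h3]
  have hrare : ∀ D, rare B M D ⊆ D := fun D => filter_subset _ _
  have hexc : ∀ D, exc B M D ⊆ D := fun D =>
    union_subset (union_subset (hrare D) (filter_subset _ _)) (filter_subset _ _)
  have e1 := edge_sum_le (Z := fun f => exc B M (cor f)) (fun f _ => hexc _) hK₁ hA₁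
  have e2 := edge_sum_le (Z := fun f => rare B M (cor f)) (fun f _ => hrare _)
    (fun f _ => hK₂ _) hA₁
  have e3 := edge_sum_up_le (Z := fun f => (rare B M (cor f)).image (· + 1))
    (fun f _ => (image_subset_image (hrare _)).trans (subset_insert _ _))
    (fun f _ => (Nat.cast_le.2 card_image_le).trans (hK₂ (cor f))) hA₂
  have h1 : ∑ f ∈ ptns (n + 1) with Poor B M (cor f), dimR f ^ 2
      = ∑ f ∈ ptns (n + 1), ∑ i ∈ cor f,
        (if Poor B M (cor f) then 1 else 0) * (dimR f * dimR (dn f i)) := by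
    rw [sum_filter]
    refine sum_congr rfl fun f hf => ?_
    rw [← mul_sum, ← mul_sum, ← dimR_succ (mem_ptns.1 hf)]
    split_ifs <;> ring
  have h2 : ∑ f ∈ ptns (n + 1), ∑ i ∈ cor f,
        (if Poor B M (cor f) then 1 else 0) * (dimR f * dimR (dn f i))
      ≤ ∑ f ∈ ptns (n + 1), ∑ i ∈ cor f,
          ((pot B M (cor (dn f i)) : ℝ) - pot B M (cor f)) * (dimR f * dimR (dn f i))
        + ∑ f ∈ ptns (n + 1), ∑ i ∈ exc B M (cor f), dimR f * dimR (dn f i)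
        + 2 * B * ∑ f ∈ ptns (n + 1), ∑ i ∈ rare B M (cor f), dimR f * dimR (dn f i) := by
    rw [mul_sum, ← sum_add_distrib, ← sum_add_distrib]
    refine sum_le_sum fun f hf => ?_
    have hs : ∀ Z ⊆ cor f, ∑ i ∈ Z, dimR f * dimR (dn f i)
        = ∑ i ∈ cor f, (if i ∈ Z then 1 else 0) * (dimR f * dimR (dn f i)) := by
      intro Z hZ
      simp only [ite_mul, one_mul, zero_mul]
      rw [← sum_filter, filter_mem_eq_inter, inter_eq_right.2 hZ]
    rw [hs _ (hexc _), hs _ (hrare _), mul_sum, ← sum_add_distrib, ← sum_add_distrib]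
    refine sum_le_sum fun i hi => ?_
    have := mul_le_mul_of_nonneg_right (pot_dn_ge (M := M) hB (mem_ptns.1 hf) hi
      (Poor B M (cor f)) id) (mul_nonneg (dimR_nonneg f) (dimR_nonneg (dn f i)))
    linarith
  have h4 : ∑ f ∈ ptns (n + 1), ∑ i ∈ cor f,
        ((pot B M (cor (dn f i)) : ℝ) - pot B M (cor f)) * (dimR f * dimR (dn f i))
      ≤ 2 * B * ∑ g ∈ ptns n, ∑ i ∈ (rare B M (cor g)).image (· + 1), dimR (up g i) * dimR g := by
    rw [sum_edges n fun f i g => ((pot B M (cor g) : ℝ) - pot B M (cor f)) * (dimR f * dimR g),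
      mul_sum]
    refine sum_le_sum fun g hg => ?_
    have hZ : (rare B M (cor g)).image (· + 1) ⊆ addable g :=
      (image_subset_image (hrare _)).trans (subset_insert _ _)
    have hs : ∑ i ∈ (rare B M (cor g)).image (· + 1), dimR (up g i) * dimR g
        = ∑ i ∈ addable g, (if i ∈ (rare B M (cor g)).image (· + 1) then 1 else 0)
          * (dimR (up g i) * dimR g) := by
      simp only [ite_mul, one_mul, zero_mul]
      rw [← sum_filter, filter_mem_eq_inter, inter_eq_right.2 hZ]
    rw [hs, mul_sum]
    refine sum_le_sum fun i hi => ?_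
    have := mul_le_mul_of_nonneg_right (pot_up_ge (B := B) (M := M) (mem_ptns.1 hg) hi)
      (mul_nonneg (dimR_nonneg (up g i)) (dimR_nonneg g))
    linarith
  rw [h1]
  have hB0 : (0 : ℝ) ≤ 2 * B := by positivity
  have e2' := mul_le_mul_of_nonneg_left e2 hB0
  have e3' := mul_le_mul_of_nonneg_left e3 hB0
  linarith

lemma IsPart.card_cor_le (h : IsPart n f) (hn : 1 ≤ n) : (#(cor f) : ℝ) ≤ 2 * √n + 1 := by
  have hs : 0 < √(n : ℝ) := Real.sqrt_pos.2 (by exact_mod_cast hn)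
  have ht : 0 < ⌈√(n : ℝ)⌉₊ := Nat.ceil_pos.2 hs
  have h1 := card_le_of_separated (I := cor f) (b := 1) one_pos ht (fun x _ y _ h => h) h.sum_cor_le
  have h2 := Nat.ceil_lt_add_one hs.le
  have h3 := Nat.le_ceil √(n : ℝ)
  have h4 : (n : ℝ) / (⌈√(n : ℝ)⌉₊ * (1 : ℕ)) ≤ √n := by
    rw [Nat.cast_one, mul_one, div_le_iff₀ (by exact_mod_cast ht)]
    calc (n : ℝ) = √n * √n := (Real.mul_self_sqrt (by positivity)).symm
      _ ≤ _ := by gcongr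
  linarith

lemma IsPart.card_isol_le (h : IsPart n f) (hn : 1 ≤ n) {b : ℕ} (hb : 1 ≤ b) :
    (#(isol (b ^ 2) (cor f)) : ℝ) ≤ 2 * (√n / b) + 1 := by
  have hs : 0 < √(n : ℝ) := Real.sqrt_pos.2 (by exact_mod_cast hn)
  have hb' : (0 : ℝ) < b := by exact_mod_cast hb
  have hsb : 0 < √(n : ℝ) / b := by positivity
  have ht : 0 < ⌈√(n : ℝ) / b⌉₊ := Nat.ceil_pos.2 hsb
  have h1 := card_le_of_separated (I := isol (b ^ 2) (cor f)) (b := b ^ 2) (n := n)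
    (by positivity) ht ?_ ?_
  · have h2 := Nat.ceil_lt_add_one hsb.le
    have h3 := Nat.le_ceil (√(n : ℝ) / b)
    have h4 : (n : ℝ) / (⌈√(n : ℝ) / b⌉₊ * (b ^ 2 : ℕ)) ≤ √n / b := by
      rw [div_le_iff₀ (by positivity)]
      calc (n : ℝ) = √n * √n := (Real.mul_self_sqrt (by positivity)).symm
        _ = √n / b * (√n / b * (b ^ 2 : ℕ)) := by push_cast; field_simp
        _ ≤ _ := by gcongr
    linarith
  · intro x hx y hy hxy
    rw [isol, mem_filter] at hx hy
    by_contra hlt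
    exact hx.2 (y - x) (by omega) (by omega) (by rw [Nat.add_sub_cancel' hxy.le]; exact hy.1)
  · exact (sum_le_sum_of_subset (filter_subset _ _)).trans h.sum_cor_le

/-- With high probability the corner set contains many pairs at two consecutive distances. -/
theorem exists_eventually_pr_poor_le {ε : ℝ} (hε : 0 < ε) :
    ∃ B : ℕ, 1 ≤ B ∧ ∃ θ : ℝ, 0 < θ ∧
      ∀ᶠ n : ℕ in atTop, pr n (fun f => Poor B ⌈θ * √n⌉₊ (cor f)) ≤ ε := by
  have hlim : Tendsto (fun b : ℕ => √(21 * (b : ℝ)⁻¹) + 4 * √12 * (b : ℝ)⁻¹) atTop (𝓝 0) := by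
    have h1 : Tendsto (fun b : ℕ => (b : ℝ)⁻¹) atTop (𝓝 0) := tendsto_inv_atTop_nhds_zero_nat
    have h2 := (Real.continuous_sqrt.tendsto _).comp (h1.const_mul 21)
    have h3 := h2.add (h1.const_mul (4 * √12))
    simpa using h3
  obtain ⟨b, hbε, hb⟩ := ((hlim.eventually_le_const hε).and (eventually_ge_atTop 1)).exists
  have hb' : (1 : ℝ) ≤ b := by exact_mod_cast hb
  have hb0 : (0 : ℝ) < b := by linarith
  refine ⟨b ^ 2, Nat.one_le_pow _ _ hb, ((b : ℝ) ^ 8)⁻¹, by positivity, ?_⟩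
  have hsq : Tendsto (fun n : ℕ => √(n : ℝ)) atTop atTop :=
    Real.tendsto_sqrt_atTop.comp tendsto_natCast_atTop_atTop
  filter_upwards [eventually_ge_atTop 2, hsq.eventually_ge_atTop (2 * (b : ℝ) ^ 8)] with N hN hs
  obtain ⟨n, rfl⟩ : ∃ n, N = n + 1 := ⟨N - 1, by omega⟩
  refine le_trans ?_ hbε
  set s := √((n + 1 : ℕ) : ℝ) with hsdef
  have hs8 : (1 : ℝ) ≤ (b : ℝ) ^ 8 := one_le_pow₀ hb'
  have hs2 : 2 ≤ s := by linarith
  have hss : s * s = (n : ℝ) + 1 := by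
    rw [hsdef, Real.mul_self_sqrt (by positivity)]; push_cast; ring
  set M := ⌈((b : ℝ) ^ 8)⁻¹ * s⌉₊ with hM
  have hM1 : (M : ℝ) + 1 ≤ 2 * (((b : ℝ) ^ 8)⁻¹ * s) := by
    have h1 := Nat.ceil_lt_add_one (a := ((b : ℝ) ^ 8)⁻¹ * s) (by positivity)
    have h2 : 2 ≤ ((b : ℝ) ^ 8)⁻¹ * s := by
      rw [inv_mul_eq_div, le_div_iff₀ (by positivity)]; exact hs
    linarith
  have hb6 : (b : ℝ) ^ 2 * ((b : ℝ) ^ 8)⁻¹ = ((b : ℝ) ^ 6)⁻¹ := by field_simp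
  have hK₂ : ∀ D, (#(rare (b ^ 2) M D) : ℝ) ≤ 4 * ((b : ℝ) ^ 6)⁻¹ * s := by
    intro D
    have h1 : (#(rare (b ^ 2) M D) : ℝ) ≤ (b : ℝ) ^ 2 * (2 * ((M : ℝ) + 1)) := by
      exact_mod_cast card_rare_le (b ^ 2) M D
    refine h1.trans ?_
    rw [← hb6]
    nlinarith [sq_nonneg (b : ℝ)]
  have hsb : 2 ≤ s / b := by
    rw [le_div_iff₀ hb0]
    have : (b : ℝ) ≤ (b : ℝ) ^ 8 := le_self_pow₀ hb' (by norm_num)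
    linarith
  have hb61 : ((b : ℝ) ^ 6)⁻¹ ≤ (b : ℝ)⁻¹ := by
    apply inv_anti₀ hb0
    exact le_self_pow₀ hb' (by norm_num)
  have hK₁ : ∀ f, IsPart (n + 1) f → (#(exc (b ^ 2) M (cor f)) : ℝ) ≤ 7 * (b : ℝ)⁻¹ * s := by
    intro f hf
    have h1 : #(exc (b ^ 2) M (cor f))
        ≤ #(rare (b ^ 2) M (cor f)) + #(isol (b ^ 2) (cor f)) + 1 := by
      refine (card_union_le _ _).trans (add_le_add (card_union_le _ _) ?_)
      rw [card_le_one]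
      intro x hx y hy
      rw [(mem_filter.1 hx).2, (mem_filter.1 hy).2]
    have h1' : (#(exc (b ^ 2) M (cor f)) : ℝ)
        ≤ #(rare (b ^ 2) M (cor f)) + #(isol (b ^ 2) (cor f)) + 1 := by exact_mod_cast h1
    have h2 := hK₂ (cor f)
    have h3 := hf.card_isol_le (by omega) hb
    have h4 : 4 * ((b : ℝ) ^ 6)⁻¹ * s ≤ 4 * (b : ℝ)⁻¹ * s := by gcongr
    have h5 : s / b = (b : ℝ)⁻¹ * s := by field_simp
    rw [← hsdef, h5] at h3
    rw [h5] at hsb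
    linarith
  have hA₂ : ∀ g, IsPart (n + 1) g → (#(cor g) : ℝ) ≤ 3 * s := by
    intro g hg
    have := hg.card_cor_le (by omega)
    rw [← hsdef] at this
    linarith
  have hA₁ : ∀ g, IsPart n g → (#(addable g) : ℝ) ≤ 3 * s := by
    intro g hg
    have h1 := hg.card_cor_le (by omega)
    have h2 : (#(addable g) : ℝ) ≤ #(cor g) + 1 := by
      exact_mod_cast (card_insert_le _ _).trans (Nat.succ_le_succ card_image_le)
    have h3 : √(n : ℝ) ≤ s := Real.sqrt_le_sqrt (by push_cast; linarith)
    linarith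
  refine (sum_poor_le (Nat.one_le_pow _ _ hb) hK₁ hK₂ hA₁ hA₂).trans ?_
  rw [← hss]
  have hs0 : s ≠ 0 := by positivity
  have e1 : 7 * (b : ℝ)⁻¹ * s * (3 * s) / (s * s) = 21 * (b : ℝ)⁻¹ := by field_simp; norm_num
  have e2 : 4 * ((b : ℝ) ^ 6)⁻¹ * s * (3 * s) / (s * s) = 12 * (((b : ℝ) ^ 3)⁻¹) ^ 2 := by
    field_simp; norm_num
  rw [e1, e2, Real.sqrt_mul (by norm_num), Real.sqrt_mul (by norm_num),
    Real.sqrt_sq (by positivity)]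
  have e3 : 4 * ((b ^ 2 : ℕ) : ℝ) * (√12 * ((b : ℝ) ^ 3)⁻¹) = 4 * √12 * (b : ℝ)⁻¹ := by
    push_cast; field_simp
  rw [e3]

end

/-! ### Labelling columns -/

section

open Finset Filter Topology

/-- Total weight of the first `n` columns carrying the label `q`. -/
def wt (w : ℕ → ℤ) (n : ℕ) (a : ℕ → Fin 4) (q : Fin 4) : ℤ :=
  ∑ j ∈ range n, if a j = q then w j else 0

/-- Number of the first `x` columns carrying the label `q`. -/
def cnt (a : ℕ → Fin 4) (q : Fin 4) (x : ℕ) : ℕ := #{j ∈ range x | a j = q}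

lemma wt_update (w : ℕ → ℤ) {n x : ℕ} (hx : x < n) (a : ℕ → Fin 4) (b q : Fin 4) :
    wt w n (Function.update a x b) q
      = wt w n a q + (if b = q then w x else 0) - (if a x = q then w x else 0) := by
  unfold wt
  rw [← add_sum_erase _ _ (mem_range.2 hx), ← add_sum_erase (a := x) _ _ (mem_range.2 hx),
    Function.update_self]
  have : ∑ j ∈ (range n).erase x, (if Function.update a x b j = q then w j else 0)
      = ∑ j ∈ (range n).erase x, (if a j = q then w j else 0) :=
    sum_congr rfl fun j hj => by rw [Function.update_of_ne (ne_of_mem_erase hj)]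
  rw [this]
  ring

lemma cnt_update_le (a : ℕ → Fin 4) (x : ℕ) (b q : Fin 4) (k : ℕ) :
    cnt (Function.update a x b) q k ≤ cnt a q k + 1 := by
  unfold cnt
  refine (card_le_card ?_).trans (card_insert_le x _)
  intro j
  simp only [mem_filter, mem_insert]
  rintro ⟨h1, h2⟩
  by_cases h : j = x
  · exact Or.inl h
  · rw [Function.update_of_ne h] at h2
    exact Or.inr ⟨h1, h2⟩

/-- The blocks of four consecutive columns met by a pair of columns. -/
def blk (u : ℕ × ℕ) : Finset ℕ := {u.1 / 4, u.2 / 4}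

/-- The blocks of four consecutive columns met by a set of pairs of columns. -/
def blks (S : Finset (ℕ × ℕ)) : Finset ℕ := S.biUnion blk

lemma blks_mono {S T : Finset (ℕ × ℕ)} (h : S ⊆ T) : blks S ⊆ blks T :=
  biUnion_subset_biUnion_of_subset_left _ h

lemma card_blks_le (S : Finset (ℕ × ℕ)) : #(blks S) ≤ 2 * #S := by
  rw [mul_comm]
  exact card_biUnion_le_card_mul _ _ _ fun u _ => card_le_two

/-- Exchange the labels of several disjoint pairs of columns. -/
lemma exists_swap (w : ℕ → ℤ) {n : ℕ} {p : Fin 4} (hp : p ≠ 0) (a : ℕ → Fin 4)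
    (S : Finset (ℕ × ℕ)) (hS : ∀ u ∈ S, u.1 < n ∧ u.2 < n ∧ a u.1 = p ∧ a u.2 = 0)
    (hd : (S : Set (ℕ × ℕ)).PairwiseDisjoint blk) :
    ∃ a' : ℕ → Fin 4, (∀ j, j / 4 ∉ blks S → a' j = a j) ∧
      wt w n a' p = wt w n a p + ∑ u ∈ S, (w u.2 - w u.1) ∧
      (∀ q, q ≠ p → q ≠ 0 → wt w n a' q = wt w n a q) ∧
      ∀ q x, cnt a' q x ≤ cnt a q x + 2 * #S := by
  induction S using Finset.induction_on with
  | empty => exact ⟨a, by simp⟩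
  | insert u S hu ih =>
    obtain ⟨a', h1, h2, h3, h4⟩ := ih (fun v hv => hS v (mem_insert_of_mem hv))
      (hd.subset (by simp))
    have hblk : ∀ k ∈ blk u, k ∉ blks S := by
      intro k hk hkS
      obtain ⟨v, hv, hkv⟩ := mem_biUnion.1 hkS
      have := hd (by simp) (by simp [hv]) (show u ≠ v by rintro rfl; exact hu hv)
      exact (Finset.disjoint_left.1 this) hk hkv
    obtain ⟨hx, hy, hax, hay⟩ := hS u (mem_insert_self _ _)
    have hax' : a' u.1 = p := by rw [h1 _ (hblk _ (by simp [blk])), hax]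
    have hay' : a' u.2 = 0 := by rw [h1 _ (hblk _ (by simp [blk])), hay]
    have hne : u.2 ≠ u.1 := by
      intro h; rw [h, hax'] at hay'; exact hp hay'
    refine ⟨Function.update (Function.update a' u.1 0) u.2 p, ?_, ?_, ?_, ?_⟩
    · intro j hj
      have hj1 : j ≠ u.1 := by
        rintro rfl; exact hj (by simp [blks, blk])
      have hj2 : j ≠ u.2 := by
        rintro rfl; exact hj (by simp [blks, blk])
      rw [Function.update_of_ne hj2, Function.update_of_ne hj1]
      exact h1 j fun h => hj (blks_mono (subset_insert _ _) h)
    · rw [wt_update w hy, wt_update w hx, Function.update_of_ne hne, hax', hay', h2,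
        sum_insert hu]
      simp [hp.symm]
      ring
    · intro q hqp hq0
      rw [wt_update w hy, wt_update w hx, Function.update_of_ne hne, hax', hay', h3 q hqp hq0]
      simp [hqp.symm, hq0.symm]
    · intro q x
      have e1 := cnt_update_le (Function.update a' u.1 0) u.2 p q x
      have e2 := cnt_update_le a' u.1 0 q x
      have e3 := h4 q x
      rw [card_insert_of_notMem hu]
      omega

/-- The labelling obtained from a permutation of labels in each block of four columns. -/
def assign (π : ℕ → Equiv.Perm (Fin 4)) (j : ℕ) : Fin 4 := π (j / 4) (Fin.ofNat 4 j)

lemma assign_block (π : ℕ → Equiv.Perm (Fin 4)) (k : ℕ) (c : Fin 4) :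
    assign π (4 * k + c) = π k c := by
  unfold assign
  congr 1
  · congr 1; omega
  · ext; simp [Fin.ofNat]

lemma eq_of_block {x y : ℕ} (h : x / 4 = y / 4) (h' : Fin.ofNat 4 x = Fin.ofNat 4 y) : x = y := by
  have := congrArg Fin.val h'
  simp only [Fin.ofNat] at this
  omega

lemma cnt_assign_le (π : ℕ → Equiv.Perm (Fin 4)) (q : Fin 4) (x : ℕ) :
    cnt (assign π) q x ≤ x / 4 + 1 := by
  unfold cnt
  refine (card_le_card_of_injOn (t := range (x / 4 + 1)) (fun j => j / 4) ?_ ?_).trans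
    (card_range _).le
  · intro j hj
    simp only [coe_filter, mem_range, Set.mem_ofPred_eq] at hj
    simp only [coe_range, Set.mem_Iio]
    omega
  · intro j hj k hk h
    simp only [coe_filter, mem_range, Set.mem_ofPred_eq] at hj hk h
    refine eq_of_block h ((π (j / 4)).injective ?_)
    have := hj.2.trans hk.2.symm
    unfold assign at this
    rwa [← h] at this

lemma wt_assign_succ (w : ℕ → ℤ) (π : ℕ → Equiv.Perm (Fin 4)) (q : Fin 4) (K : ℕ) :
    wt w (4 * (K + 1)) (assign π) q = wt w (4 * K) (assign π) q + w (4 * K + (π K).symm q) := by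
  have h1 : wt w (4 * (K + 1)) (assign π) q = wt w (4 * K) (assign π) q
      + ∑ c : Fin 4, if assign π (4 * K + c) = q then w (4 * K + c) else 0 := by
    unfold wt
    rw [show 4 * (K + 1) = 4 * K + 4 by ring, sum_range_add]
    congr 1
  rw [h1]
  congr 1
  simp only [assign_block, ← Equiv.eq_symm_apply]
  rw [sum_ite_eq' univ ((π K).symm q) (fun c : Fin 4 => w (4 * K + c)), if_pos (mem_univ _)]

lemma wt_assign_sub_le {w : ℕ → ℤ} (hw : Antitone w) (π : ℕ → Equiv.Perm (Fin 4)) (q q' : Fin 4)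
    (K : ℕ) : wt w (4 * K) (assign π) q - wt w (4 * K) (assign π) q' ≤ w 0 - w (4 * K) := by
  induction K with
  | zero => simp [wt]
  | succ K ih =>
    rw [wt_assign_succ, wt_assign_succ]
    have h1 : w (4 * K + (π K).symm q) ≤ w (4 * K) := hw (by omega)
    have h2 : w (4 * (K + 1)) ≤ w (4 * K + (π K).symm q') := hw (by omega)
    linarith

lemma sum_wt (w : ℕ → ℤ) (n : ℕ) (a : ℕ → Fin 4) : ∑ q, wt w n a q = ∑ j ∈ range n, w j := by
  unfold wt
  rw [sum_comm]
  exact sum_congr rfl fun j _ => by simp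

lemma abs_wt_assign_le {w : ℕ → ℤ} (hw : Antitone w) (π : ℕ → Equiv.Perm (Fin 4)) (q : Fin 4)
    (K : ℕ) (h0 : 0 ≤ w (4 * K)) :
    |4 * wt w (4 * K) (assign π) q - ∑ j ∈ range (4 * K), w j| ≤ 3 * w 0 := by
  rw [← sum_wt w (4 * K) (assign π), Fin.sum_univ_four, abs_le]
  have hA := fun q' => wt_assign_sub_le hw π q q' K
  have hB := fun q' => wt_assign_sub_le hw π q' q K
  have a0 := hA 0; have a1 := hA 1; have a2 := hA 2; have a3 := hA 3
  have b0 := hB 0; have b1 := hB 1; have b2 := hB 2; have b3 := hB 3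
  have hpos : 0 ≤ w 0 := h0.trans (hw (Nat.zero_le _))
  fin_cases q <;> simp only [Fin.zero_eta, Fin.mk_one, Fin.reduceFinMk] at * <;>
    constructor <;> linarith

lemma exists_perm_fin_four {x y p : Fin 4} (h : x ≠ y) (hp : p ≠ 0) :
    ∃ π : Equiv.Perm (Fin 4), π x = p ∧ π y = 0 := by
  refine ⟨Equiv.swap (Equiv.swap x p y) 0 * Equiv.swap x p, ?_, ?_⟩
  · have h1 : Equiv.swap x p y ≠ p := by
      intro h2
      exact h ((Equiv.swap x p).injective ((Equiv.swap_apply_left x p).trans h2.symm))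
    rw [Equiv.Perm.mul_apply, Equiv.swap_apply_left, Equiv.swap_apply_of_ne_of_ne h1.symm hp]
  · rw [Equiv.Perm.mul_apply, Equiv.swap_apply_left]

/-- Labels prescribed on disjoint pairs of columns extend to permutations of all blocks. -/
lemma exists_assign (P : Finset (ℕ × ℕ)) (lab : ℕ × ℕ → Fin 4) (hlab : ∀ u ∈ P, lab u ≠ 0)
    (hne : ∀ u ∈ P, u.1 ≠ u.2) (hd : (P : Set (ℕ × ℕ)).PairwiseDisjoint blk) :
    ∃ π, ∀ u ∈ P, assign π u.1 = lab u ∧ assign π u.2 = 0 := by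
  have key : ∀ k : ℕ, ∃ π : Equiv.Perm (Fin 4), ∀ u ∈ P,
      (u.1 / 4 = k → π (Fin.ofNat 4 u.1) = lab u) ∧ (u.2 / 4 = k → π (Fin.ofNat 4 u.2) = 0) := by
    intro k
    by_cases h : ∃ u ∈ P, k ∈ blk u
    · obtain ⟨u, hu, hk⟩ := h
      have huniq : ∀ v ∈ P, k ∈ blk v → v = u := by
        intro v hv hkv
        by_contra hvu
        exact (Finset.disjoint_left.1 (hd hv hu hvu)) hkv hk
      suffices ∃ π : Equiv.Perm (Fin 4), (u.1 / 4 = k → π (Fin.ofNat 4 u.1) = lab u) ∧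
          (u.2 / 4 = k → π (Fin.ofNat 4 u.2) = 0) by
        obtain ⟨π, hπ⟩ := this
        refine ⟨π, fun v hv => ⟨fun h => ?_, fun h => ?_⟩⟩
        · obtain rfl := huniq v hv (by simp [blk, h])
          exact hπ.1 h
        · obtain rfl := huniq v hv (by simp [blk, h])
          exact hπ.2 h
      by_cases hs : u.1 / 4 = u.2 / 4
      · have : Fin.ofNat 4 u.1 ≠ Fin.ofNat 4 u.2 := fun h => hne u hu (eq_of_block hs h)
        obtain ⟨π, h1, h2⟩ := exists_perm_fin_four this (hlab u hu)
        exact ⟨π, fun _ => h1, fun _ => h2⟩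
      · by_cases h1 : u.1 / 4 = k
        · exact ⟨Equiv.swap (Fin.ofNat 4 u.1) (lab u), fun _ => Equiv.swap_apply_left _ _,
            fun h2 => absurd (h1.trans h2.symm) hs⟩
        · exact ⟨Equiv.swap (Fin.ofNat 4 u.2) 0, fun h2 => absurd h2 h1,
            fun _ => Equiv.swap_apply_left _ _⟩
    · refine ⟨1, fun u hu => ⟨fun h1 => ?_, fun h1 => ?_⟩⟩
      · exact absurd ⟨u, hu, by simp [blk, h1]⟩ h
      · exact absurd ⟨u, hu, by simp [blk, h1]⟩ h
  choose π hπ using key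
  exact ⟨π, fun u hu => ⟨(hπ _ u hu).1 rfl, (hπ _ u hu).2 rfl⟩⟩

end

/-! ### Pools of exchangeable pairs of columns -/

section

open Finset Filter Topology

/-- `τ` is a total weight change obtained by exchanging labels on some of the given pairs. -/
def Reach (w : ℕ → ℤ) (P : Finset (ℕ × ℕ)) (τ : ℤ) : Prop :=
  ∃ S ⊆ P, ∑ u ∈ S, (w u.2 - w u.1) = τ

/-- Pairs satisfying `T` exist outside every set of at most `R` blocks. -/
def Avail (T : ℕ × ℕ → Prop) (R : ℕ) : Prop :=
  ∀ E : Finset ℕ, #E ≤ R → ∃ u, T u ∧ Disjoint (blk u) E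

lemma disjoint_of_blks {S T : Finset (ℕ × ℕ)} (h : Disjoint (blks S) (blks T)) :
    Disjoint S T := by
  rw [Finset.disjoint_left] at h ⊢
  intro u hS hT
  have hu : u.1 / 4 ∈ blk u := by simp [blk]
  exact h (mem_biUnion.2 ⟨u, hS, hu⟩) (mem_biUnion.2 ⟨u, hT, hu⟩)

lemma blks_union (S T : Finset (ℕ × ℕ)) : blks (S ∪ T) = blks S ∪ blks T := union_biUnion

lemma pairwiseDisjoint_union {S T : Finset (ℕ × ℕ)} (hS : (S : Set (ℕ × ℕ)).PairwiseDisjoint blk)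
    (hT : (T : Set (ℕ × ℕ)).PairwiseDisjoint blk) (h : Disjoint (blks S) (blks T)) :
    ((S ∪ T : Finset (ℕ × ℕ)) : Set (ℕ × ℕ)).PairwiseDisjoint blk := by
  rw [coe_union, Set.pairwiseDisjoint_union]
  refine ⟨hS, hT, fun u hu v hv _ => ?_⟩
  exact h.mono (subset_biUnion_of_mem blk hu) (subset_biUnion_of_mem blk hv)

lemma Avail.exists_family {T : ℕ × ℕ → Prop} {R : ℕ} (h : Avail T R) (K : ℕ) (E : Finset ℕ)
    (hE : #E + 2 * K ≤ R) :
    ∃ S : Finset (ℕ × ℕ), #S = K ∧ (∀ u ∈ S, T u) ∧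
      (S : Set (ℕ × ℕ)).PairwiseDisjoint blk ∧ Disjoint (blks S) E := by
  induction K with
  | zero => exact ⟨∅, by simp [blks]⟩
  | succ K ih =>
    obtain ⟨S, h1, h2, h3, h4⟩ := ih (by omega)
    have hc := card_union_le E (blks S)
    have hc' := card_blks_le S
    obtain ⟨u, hu, hd⟩ := h (E ∪ blks S) (by omega)
    rw [disjoint_union_right] at hd
    have hb : blks {u} = blk u := singleton_biUnion
    have hdS : Disjoint (blks {u}) (blks S) := by rw [hb]; exact hd.2
    have huS : u ∉ S := by simpa using disjoint_of_blks hdS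
    refine ⟨{u} ∪ S, ?_, ?_, pairwiseDisjoint_union (by simp) h3 hdS, ?_⟩
    · rw [card_union_of_disjoint (disjoint_of_blks hdS), h1, card_singleton, add_comm]
    · intro v hv
      rcases mem_union.1 hv with hv | hv
      · rw [mem_singleton.1 hv]; exact hu
      · exact h2 v hv
    · rw [blks_union, hb, disjoint_union_left]
      exact ⟨hd.1, h4⟩

variable {w : ℕ → ℤ}

lemma Reach.union {P P' : Finset (ℕ × ℕ)} {τ τ' : ℤ} (h : Disjoint (blks P) (blks P'))
    (hP : Reach w P τ) (hP' : Reach w P' τ') : Reach w (P ∪ P') (τ + τ') := by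
  obtain ⟨S, hS, rfl⟩ := hP
  obtain ⟨S', hS', rfl⟩ := hP'
  refine ⟨S ∪ S', union_subset_union hS hS', sum_union ?_⟩
  exact (disjoint_of_blks h).mono hS hS'

lemma reach_zero (P : Finset (ℕ × ℕ)) : Reach w P 0 := ⟨∅, by simp⟩

lemma reach_mul {P : Finset (ℕ × ℕ)} {c : ℤ} (h : ∀ u ∈ P, w u.2 - w u.1 = c) {j : ℕ}
    (hj : j ≤ #P) : Reach w P (j * c) := by
  obtain ⟨S, hS, hSj⟩ := exists_subset_card_eq hj
  exact ⟨S, hS, by rw [sum_congr rfl fun u hu => h u (hS hu), sum_const, hSj, nsmul_eq_mul]⟩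

lemma exists_subset_sum_between {ι : Type*} [DecidableEq ι] (S : Finset ι) (e : ι → ℤ) {Q t : ℤ}
    (hQ : 0 ≤ Q) (he : ∀ u ∈ S, e u ≤ Q) (ht0 : 0 ≤ t) (ht : t ≤ ∑ u ∈ S, e u) :
    ∃ S' ⊆ S, t ≤ ∑ u ∈ S', e u ∧ ∑ u ∈ S', e u ≤ t + Q := by
  induction S using Finset.induction_on with
  | empty => exact ⟨∅, by simp, ht, by simp; linarith⟩
  | insert u S hu ih =>
    by_cases h : t ≤ ∑ u ∈ S, e u
    · obtain ⟨S', h1, h2⟩ := ih (fun v hv => he v (mem_insert_of_mem hv)) h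
      exact ⟨S', h1.trans (subset_insert _ _), h2⟩
    · refine ⟨insert u S, subset_rfl, ht, ?_⟩
      rw [sum_insert hu]
      have := he u (mem_insert_self _ _)
      linarith

/-- A family of pairs whose exchanges realise every moderate change of weight. -/
lemma exists_pool {n N Q δ R : ℕ} (hN : 1 ≤ N)
    (hU : Avail (fun u => u.1 < n ∧ u.2 < n ∧ w u.2 - w u.1 = δ + 1) R)
    (hV : δ = 0 ∨ Avail (fun u => u.1 < n ∧ u.2 < n ∧ w u.2 - w u.1 = -δ) R)
    (hW : Avail (fun u => u.1 < n ∧ u.2 < n ∧ N ≤ w u.2 - w u.1 ∧ w u.2 - w u.1 ≤ Q) R)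
    (hW' : Avail (fun u => u.1 < n ∧ u.2 < n ∧ N ≤ w u.1 - w u.2 ∧ w u.1 - w u.2 ≤ Q) R)
    (E : Finset ℕ) (hE : #E + 4 * (Q + N) ≤ R) :
    ∃ P : Finset (ℕ × ℕ), #P ≤ 2 * (Q + N) ∧ (∀ u ∈ P, u.1 < n ∧ u.2 < n ∧ u.1 ≠ u.2) ∧
      (P : Set (ℕ × ℕ)).PairwiseDisjoint blk ∧ Disjoint (blks P) E ∧
      ∀ τ : ℤ, |τ| ≤ N * N → Reach w P τ := by
  obtain ⟨S₁, a1, a2, a3, a4⟩ := hU.exists_family Q E (by omega)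
  obtain ⟨S₂, b1, b2, b3, b4, b5⟩ : ∃ S : Finset (ℕ × ℕ), #S ≤ Q ∧ (δ ≠ 0 → #S = Q) ∧
      (∀ u ∈ S, δ ≠ 0 ∧ u.1 < n ∧ u.2 < n ∧ w u.2 - w u.1 = -δ) ∧
      (S : Set (ℕ × ℕ)).PairwiseDisjoint blk ∧ Disjoint (blks S) (E ∪ blks S₁) := by
    rcases hV with h0 | hV
    · exact ⟨∅, by simp [blks, h0]⟩
    · by_cases h0 : δ = 0
      · exact ⟨∅, by simp [blks, h0]⟩
      have hc := card_union_le E (blks S₁)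
      have hc' := card_blks_le S₁
      obtain ⟨S, h1, h2, h3, h4⟩ := hV.exists_family Q (E ∪ blks S₁) (by omega)
      exact ⟨S, h1.le, fun _ => h1, fun u hu => ⟨h0, h2 u hu⟩, h3, h4⟩
  have hc1 := card_union_le E (blks S₁)
  have hc1' := card_blks_le S₁
  have hc2 := card_union_le (E ∪ blks S₁) (blks S₂)
  have hc2' := card_blks_le S₂
  obtain ⟨S₃, c1, c2, c3, c4⟩ := hW.exists_family N (E ∪ blks S₁ ∪ blks S₂) (by omega)
  have hc3 := card_union_le (E ∪ blks S₁ ∪ blks S₂) (blks S₃)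
  have hc3' := card_blks_le S₃
  obtain ⟨S₄, d1, d2, d3, d4⟩ := hW'.exists_family N (E ∪ blks S₁ ∪ blks S₂ ∪ blks S₃) (by omega)
  simp only [disjoint_union_right] at b5 c4 d4
  have e12 : Disjoint (blks S₁) (blks S₂) := b5.2.symm
  have e3 : Disjoint (blks (S₁ ∪ S₂)) (blks S₃) := by
    rw [blks_union, disjoint_union_left]
    exact ⟨c4.1.2.symm, c4.2.symm⟩
  have e4 : Disjoint (blks (S₁ ∪ S₂ ∪ S₃)) (blks S₄) := by
    rw [blks_union, blks_union, disjoint_union_left, disjoint_union_left]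
    exact ⟨⟨d4.1.1.2.symm, d4.1.2.symm⟩, d4.2.symm⟩
  refine ⟨S₁ ∪ S₂ ∪ S₃ ∪ S₄, ?_, ?_, ?_, ?_, ?_⟩
  · have k1 := card_union_le (S₁ ∪ S₂ ∪ S₃) S₄
    have k2 := card_union_le (S₁ ∪ S₂) S₃
    have k3 := card_union_le S₁ S₂
    omega
  · intro u hu
    simp only [mem_union] at hu
    rcases hu with ((hu | hu) | hu) | hu
    · obtain ⟨h1, h2, h3⟩ := a2 u hu
      exact ⟨h1, h2, fun h => by rw [h] at h3; omega⟩
    · obtain ⟨h0, h1, h2, h3⟩ := b3 u hu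
      exact ⟨h1, h2, fun h => by rw [h] at h3; omega⟩
    · obtain ⟨h1, h2, h3, _⟩ := c2 u hu
      exact ⟨h1, h2, fun h => by rw [h] at h3; omega⟩
    · obtain ⟨h1, h2, h3, _⟩ := d2 u hu
      exact ⟨h1, h2, fun h => by rw [h] at h3; omega⟩
  · exact pairwiseDisjoint_union (pairwiseDisjoint_union
      (pairwiseDisjoint_union a3 b4 e12) c3 e3) d3 e4
  · rw [blks_union, blks_union, blks_union]
    simp only [disjoint_union_left]
    exact ⟨⟨⟨a4, b5.1⟩, c4.1.1⟩, d4.1.1.1⟩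
  · intro τ hτ
    have hunit : ∀ j : ℤ, 0 ≤ j → j ≤ Q → Reach w (S₁ ∪ S₂) j := by
      intro j hj0 hjQ
      lift j to ℕ using hj0
      have hj : j ≤ Q := by exact_mod_cast hjQ
      have r1 : Reach w S₁ (j * (δ + 1)) := reach_mul (fun u hu => (a2 u hu).2.2) (by omega)
      have r2 : Reach w S₂ (j * (-δ)) := by
        by_cases h0 : δ = 0
        · rw [h0]; simpa using reach_zero S₂
        · exact reach_mul (fun u hu => (b3 u hu).2.2.2) (by rw [b2 h0]; exact hj)
      have := r1.union e12 r2
      rwa [show (j : ℤ) * (δ + 1) + j * (-δ) = j by ring] at this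
    have hQ : (0 : ℤ) ≤ Q := by positivity
    have hs3 : (N : ℤ) * N ≤ ∑ u ∈ S₃, (w u.2 - w u.1) := by
      have := card_nsmul_le_sum S₃ (fun u => w u.2 - w u.1) N fun u hu => (c2 u hu).2.2.1
      rwa [c1, nsmul_eq_mul] at this
    have hs4 : (N : ℤ) * N ≤ ∑ u ∈ S₄, (w u.1 - w u.2) := by
      have := card_nsmul_le_sum S₄ (fun u => w u.1 - w u.2) N fun u hu => (d2 u hu).2.2.1
      rwa [d1, nsmul_eq_mul] at this
    rw [abs_le] at hτ
    by_cases h1 : 0 ≤ τ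
    · by_cases h2 : τ ≤ Q
      · have := ((hunit τ h1 h2).union e3 (reach_zero S₃)).union e4 (reach_zero S₄)
        simpa using this
      · obtain ⟨S, hS, h3, h4⟩ := exists_subset_sum_between S₃ (fun u => w u.2 - w u.1) hQ
          (fun u hu => (c2 u hu).2.2.2) (t := τ - Q) (by linarith) (by linarith)
        have := ((hunit (τ - ∑ u ∈ S, (w u.2 - w u.1)) (by linarith) (by linarith)).union e3
          ⟨S, hS, rfl⟩).union e4 (reach_zero S₄)
        simpa using this
    · obtain ⟨S, hS, h3, h4⟩ := exists_subset_sum_between S₄ (fun u => w u.1 - w u.2) hQ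
          (fun u hu => (d2 u hu).2.2.2) (t := -τ) (by linarith) (by linarith)
      have h5 : ∑ u ∈ S, (w u.2 - w u.1) = - ∑ u ∈ S, (w u.1 - w u.2) := by
        rw [← sum_neg_distrib]
        exact sum_congr rfl fun u _ => by ring
      have := ((hunit (τ + ∑ u ∈ S, (w u.1 - w u.2)) (by linarith) (by linarith)).union e3
          (reach_zero S₃)).union e4 ⟨S, hS, h5⟩
      convert this using 1
      ring

end

/-! ### Splitting a partition into four -/

section

open Finset Filter Topology

/-- The height of the column `j` of a partition with at most `n` rows. -/
def hgt (n : ℕ) (f : ℕ → ℕ) (j : ℕ) : ℤ := #{i ∈ range n | j < f i}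

variable {n : ℕ} {f : ℕ → ℕ}

lemma hgt_antitone (n : ℕ) (f : ℕ → ℕ) : Antitone (hgt n f) := by
  intro j k hjk
  unfold hgt
  gcongr

lemma hgt_nonneg (n : ℕ) (f : ℕ → ℕ) (j : ℕ) : 0 ≤ hgt n f j := Int.natCast_nonneg _

lemma IsPart.hgt_column (h : IsPart n f) {i : ℕ} (hi : i ∈ cor f) :
    hgt n f (f (i + 1)) = i + 1 := by
  rw [h.mem_cor] at hi
  have hin : i < n := by
    by_contra hn
    rw [h.zero i (not_lt.1 hn)] at hi
    omega
  have : {k ∈ range n | f (i + 1) < f k} = range (i + 1) := by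
    ext k
    simp only [mem_filter, mem_range]
    constructor
    · rintro ⟨_, hk⟩
      by_contra hki
      exact absurd (h.anti (not_lt.1 hki)) (by omega)
    · intro hk
      exact ⟨by omega, lt_of_lt_of_le hi (h.anti (by omega))⟩
  unfold hgt
  rw [this, card_range]
  push_cast
  ring

lemma IsPart.column_lt (h : IsPart n f) {i : ℕ} (hi : i ∈ cor f) : f (i + 1) < n :=
  lt_of_lt_of_le (h.mem_cor.1 hi) (h.le i)

lemma sum_cnt_eq_wt (a : ℕ → Fin 4) (q : Fin 4) {K : ℕ} (hK : ∀ i, f i ≤ K) :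
    ((∑ i ∈ range n, cnt a q (f i) : ℕ) : ℤ) = wt (hgt n f) K a q := by
  have h1 : ∀ i, (cnt a q (f i) : ℤ) = ∑ j ∈ range K, if a j = q then (if j < f i then 1 else 0)
      else 0 := by
    intro i
    rw [cnt, card_filter]
    push_cast
    rw [← sum_subset (s₁ := range (f i)) (s₂ := range K) (by simpa using hK i)]
    · refine sum_congr rfl fun j hj => ?_
      rw [if_pos (mem_range.1 hj)]
    · intro j _ hj
      rw [if_neg (show ¬ j < f i by simpa using hj), ite_self]
  push_cast
  rw [sum_congr rfl fun i _ => h1 i, sum_comm]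
  refine sum_congr rfl fun j _ => ?_
  split_ifs
  · rw [hgt, card_filter]
    push_cast
    rfl
  · simp

/-- The corners whose column lies in one of the given blocks. -/
noncomputable def blocked (f : ℕ → ℕ) (E : Finset ℕ) : Finset ℕ := {x ∈ cor f | f (x + 1) / 4 ∈ E}

lemma IsPart.card_blocked_le (h : IsPart n f) (E : Finset ℕ) : #(blocked f E) ≤ 4 * #E := by
  have : #(blocked f E) ≤ #(E ×ˢ range 4) := by
    refine card_le_card_of_injOn (fun x => (f (x + 1) / 4, f (x + 1) % 4)) ?_ ?_
    · intro x hx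
      simp only [blocked, coe_filter, Set.mem_ofPred_eq] at hx
      simp only [coe_product, Set.mem_prod, mem_coe, mem_range]
      exact ⟨hx.2, by omega⟩
    · intro x hx y hy hxy
      simp only [Prod.mk.injEq] at hxy
      have hf : f (x + 1) = f (y + 1) := by omega
      have h1 := h.hgt_column (mem_filter.1 hx).1
      have h2 := h.hgt_column (mem_filter.1 hy).1
      rw [hf, h2] at h1
      omega
  rwa [card_product, card_range, mul_comm] at this

lemma IsPart.exists_free_pair (h : IsPart n f) {δ R : ℕ} (hR : 8 * R < prs (cor f) δ)
    {E : Finset ℕ} (hE : #E ≤ R) :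
    ∃ x ∈ cor f, x + δ ∈ cor f ∧ f (x + 1) / 4 ∉ E ∧ f (x + δ + 1) / 4 ∉ E := by
  by_contra! hcon
  have hsub : {x ∈ cor f | x + δ ∈ cor f} ⊆ blocked f E ∪ (blocked f E).image (· - δ) := by
    intro x hx
    rw [mem_filter] at hx
    by_cases h1 : f (x + 1) / 4 ∈ E
    · exact mem_union_left _ (mem_filter.2 ⟨hx.1, h1⟩)
    · exact mem_union_right _ (mem_image.2 ⟨x + δ, mem_filter.2 ⟨hx.2, hcon x hx.1 hx.2 h1⟩,
        by simp⟩)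
  have h1 := card_le_card hsub
  have h2 := card_union_le (blocked f E) ((blocked f E).image (· - δ))
  have h3 := card_image_le (s := blocked f E) (f := (· - δ))
  have h4 := h.card_blocked_le E
  unfold prs at hR
  omega

lemma IsPart.exists_free_far_pair (h : IsPart n f) {R N Q L : ℕ} (hQ : 0 < Q)
    (hL : ∀ x ∈ cor f, x < L) (hR : 4 * R + (L / Q + 1) * N < #(cor f))
    {E : Finset ℕ} (hE : #E ≤ R) :
    ∃ x ∈ cor f, ∃ y ∈ cor f, x + N ≤ y ∧ y ≤ x + Q ∧ f (x + 1) / 4 ∉ E ∧ f (y + 1) / 4 ∉ E := by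
  have h1 : (L / Q + 1) * N < #(cor f \ blocked f E) := by
    have := le_card_sdiff (blocked f E) (cor f)
    have := h.card_blocked_le E
    omega
  have hmaps : ∀ x ∈ cor f \ blocked f E, x / Q ∈ range (L / Q + 1) := by
    intro x hx
    rw [mem_range, Nat.lt_succ_iff]
    exact Nat.div_le_div_right (hL x (mem_sdiff.1 hx).1).le
  obtain ⟨k, _, hk⟩ := exists_lt_card_fiber_of_mul_lt_card_of_maps_to hmaps
    (by rwa [card_range])
  set W := {x ∈ cor f \ blocked f E | x / Q = k} with hW
  have hne : W.Nonempty := card_pos.1 (by omega)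
  have hmem : ∀ x ∈ W, x ∈ cor f ∧ f (x + 1) / 4 ∉ E ∧ x / Q = k := by
    intro x hx
    obtain ⟨hx1, hx2⟩ := mem_filter.1 hx
    obtain ⟨hx3, hx4⟩ := mem_sdiff.1 hx1
    exact ⟨hx3, fun hE => hx4 (mem_filter.2 ⟨hx3, hE⟩), hx2⟩
  refine ⟨W.min' hne, (hmem _ (min'_mem _ _)).1, W.max' hne, (hmem _ (max'_mem _ _)).1, ?_, ?_,
    (hmem _ (min'_mem _ _)).2.1, (hmem _ (max'_mem _ _)).2.1⟩
  · have hsub : W ⊆ Icc (W.min' hne) (W.max' hne) := fun x hx =>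
      mem_Icc.2 ⟨min'_le _ _ hx, le_max' _ _ hx⟩
    have := card_le_card hsub
    rw [Nat.card_Icc] at this
    omega
  · have h2 := (hmem _ (min'_mem W hne)).2.2
    have h3 := (hmem _ (max'_mem W hne)).2.2
    have h4 := Nat.div_add_mod (W.min' hne) Q
    have h5 := Nat.div_add_mod (W.max' hne) Q
    have h6 := Nat.mod_lt (W.max' hne) hQ
    rw [h2] at h4
    rw [h3] at h5
    omega

/-- Exact splitting of a partition into four partitions of prescribed sizes, each being close to
a quarter of the given one. -/
theorem IsPart.exists_split (h : IsPart n f) {L N Q R δ : ℕ} (hN : 1 ≤ N) (hQ : 0 < Q)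
    (hL : ∀ i, L ≤ i → f i = 0) (hδ : 8 * R < prs (cor f) (δ + 1))
    (hδ' : δ = 0 ∨ 8 * R < prs (cor f) δ) (hc : 4 * R + (L / Q + 1) * N < #(cor f))
    (hR : 12 * (Q + N) ≤ R) (t : Fin 4 → ℕ) (ht : ∑ p, t p = n)
    (htn : ∀ p, |4 * (t p : ℤ) - n| + 3 * L ≤ 4 * (N * N)) :
    ∃ g : Fin 4 → ℕ → ℕ, (∀ p, IsPart (t p) (g p)) ∧ (∀ i, f i = ∑ p, g p i) ∧
      ∀ p i, 4 * g p i ≤ f i + 4 * (R + 1) := by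
  have hLc : ∀ x ∈ cor f, x < L := by
    intro x hx
    by_contra hLx
    have := h.mem_cor.1 hx
    rw [hL x (not_lt.1 hLx)] at this
    omega
  set w := hgt n f with hw
  have hpair : ∀ δ : ℕ, 8 * R < prs (cor f) δ →
      Avail (fun u => u.1 < 4 * n ∧ u.2 < 4 * n ∧ w u.2 - w u.1 = δ) R := by
    intro δ hδ E hE
    obtain ⟨x, hx, hy, h1, h2⟩ := h.exists_free_pair hδ hE
    refine ⟨(f (x + 1), f (x + δ + 1)), ⟨?_, ?_, ?_⟩, by simp [blk, h1, h2]⟩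
    · have := h.column_lt hx; dsimp only; omega
    · have := h.column_lt hy; dsimp only; omega
    · dsimp only
      rw [hw, h.hgt_column hx, h.hgt_column hy]
      push_cast; ring
  have hpair' : ∀ δ : ℕ, 8 * R < prs (cor f) δ →
      Avail (fun u => u.1 < 4 * n ∧ u.2 < 4 * n ∧ w u.2 - w u.1 = -δ) R := by
    intro δ hδ E hE
    obtain ⟨u, ⟨h1, h2, h3⟩, h4⟩ := hpair δ hδ E hE
    refine ⟨(u.2, u.1), ⟨h2, h1, ?_⟩, ?_⟩
    · dsimp only; linarith
    · rwa [blk, pair_comm]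
  have hfar : Avail (fun u => u.1 < 4 * n ∧ u.2 < 4 * n ∧ N ≤ w u.2 - w u.1
      ∧ w u.2 - w u.1 ≤ Q) R := by
    intro E hE
    obtain ⟨x, hx, y, hy, h1, h2, h3, h4⟩ := h.exists_free_far_pair hQ hLc hc hE
    refine ⟨(f (x + 1), f (y + 1)), ⟨?_, ?_, ?_⟩, by simp [blk, h3, h4]⟩
    · have := h.column_lt hx; dsimp only; omega
    · have := h.column_lt hy; dsimp only; omega
    · dsimp only
      rw [hw, h.hgt_column hx, h.hgt_column hy]
      omega
  have hfar' : Avail (fun u => u.1 < 4 * n ∧ u.2 < 4 * n ∧ N ≤ w u.1 - w u.2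
      ∧ w u.1 - w u.2 ≤ Q) R := by
    intro E hE
    obtain ⟨u, ⟨h1, h2, h3⟩, h4⟩ := hfar E hE
    exact ⟨(u.2, u.1), ⟨h2, h1, h3⟩, by rwa [blk, pair_comm]⟩
  have hpool := exists_pool hN (by exact_mod_cast hpair _ hδ) (hδ'.imp_right (hpair' _)) hfar hfar'
  obtain ⟨P₁, a1, a2, a3, _, a5⟩ := hpool ∅ (by simp; omega)
  have k1 := card_blks_le P₁
  obtain ⟨P₂, b1, b2, b3, b4, b5⟩ := hpool (blks P₁) (by omega)
  have k2 := card_blks_le P₂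
  have k3 := card_union_le (blks P₁) (blks P₂)
  obtain ⟨P₃, c1, c2, c3, c4, c5⟩ := hpool (blks P₁ ∪ blks P₂) (by omega)
  rw [disjoint_union_right] at c4
  have e12 := b4.symm
  have e3 : Disjoint (blks (P₁ ∪ P₂)) (blks P₃) := by
    rw [blks_union, disjoint_union_left]
    exact ⟨c4.1.symm, c4.2.symm⟩
  obtain ⟨π, hπ⟩ := exists_assign (P₁ ∪ P₂ ∪ P₃)
    (fun u => if u ∈ P₁ then 1 else if u ∈ P₂ then 2 else 3)
    (by intro u _; split_ifs <;> decide)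
    (by
      intro u hu
      rcases mem_union.1 hu with hu | hu
      · rcases mem_union.1 hu with hu | hu
        · exact (a2 u hu).2.2
        · exact (b2 u hu).2.2
      · exact (c2 u hu).2.2)
    (pairwiseDisjoint_union (pairwiseDisjoint_union a3 b3 e12) c3 e3)
  set a₀ := assign π with ha₀
  have l1 : ∀ u ∈ P₁, a₀ u.1 = 1 ∧ a₀ u.2 = 0 := by
    intro u hu
    have := hπ u (by simp [hu])
    rwa [if_pos hu] at this
  have l2 : ∀ u ∈ P₂, a₀ u.1 = 2 ∧ a₀ u.2 = 0 := by
    intro u hu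
    have := hπ u (by simp [hu])
    have hn : u ∉ P₁ := fun h => Finset.disjoint_left.1 (disjoint_of_blks e12) h hu
    rwa [if_neg hn, if_pos hu] at this
  have l3 : ∀ u ∈ P₃, a₀ u.1 = 3 ∧ a₀ u.2 = 0 := by
    intro u hu
    have := hπ u (by simp [hu])
    have hn1 : u ∉ P₁ := fun h => Finset.disjoint_left.1 (disjoint_of_blks c4.1) hu h
    have hn2 : u ∉ P₂ := fun h => Finset.disjoint_left.1 (disjoint_of_blks c4.2) hu h
    rwa [if_neg hn1, if_neg hn2] at this
  have hfn : ∀ i, f i ≤ 4 * n := fun i => (h.le i).trans (by omega)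
  have hwsum : ∑ j ∈ range (4 * n), w j = n := by
    rw [← sum_wt w _ a₀, hw, sum_congr rfl fun q _ => (sum_cnt_eq_wt a₀ q hfn).symm]
    rw [← Nat.cast_sum, sum_comm, Nat.cast_inj]
    refine Eq.trans (sum_congr rfl fun i _ => ?_) h.sum
    unfold cnt
    have := card_eq_sum_card_fiberwise (f := a₀) (s := range (f i)) (t := univ) (by simp)
    rw [← this, card_range]
  have hw0 : w 0 ≤ L := by
    have : #{i ∈ range n | 0 < f i} ≤ #(range L) := by
      apply card_le_card
      intro i hi
      rw [mem_filter] at hi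
      rw [mem_range]
      by_contra hLi
      rw [hL i (not_lt.1 hLi)] at hi
      omega
    rw [card_range] at this
    rw [hw, hgt]
    exact_mod_cast this
  have hdev : ∀ q, |(t q : ℤ) - wt w (4 * n) a₀ q| ≤ N * N := by
    intro q
    have h1 := abs_wt_assign_le (hgt_antitone n f) π q n (hgt_nonneg _ _ _)
    rw [← hw, hwsum] at h1
    have h2 := htn q
    have h3 := abs_sub_le (4 * (t q : ℤ)) n (4 * wt w (4 * n) a₀ q)
    rw [abs_sub_comm (n : ℤ), ← mul_sub, abs_mul] at h3
    norm_num at h3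
    rw [← ha₀] at h1
    linarith
  have hsub4 : ∀ {P : Finset (ℕ × ℕ)} {S}, S ⊆ P → ∀ {j}, j / 4 ∉ blks P → j / 4 ∉ blks S :=
    fun hS _ hj hj' => hj (blks_mono hS hj')
  have hmem : ∀ {P : Finset (ℕ × ℕ)} {u}, u ∈ P → u.1 / 4 ∈ blks P ∧ u.2 / 4 ∈ blks P := by
    intro P u hu
    exact ⟨mem_biUnion.2 ⟨u, hu, by simp [blk]⟩, mem_biUnion.2 ⟨u, hu, by simp [blk]⟩⟩
  obtain ⟨S₁, hS₁, hs1⟩ := a5 _ (hdev 1)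
  obtain ⟨S₂, hS₂, hs2⟩ := b5 _ (hdev 2)
  obtain ⟨S₃, hS₃, hs3⟩ := c5 _ (hdev 3)
  obtain ⟨a₁, p1, p2, p3, p4⟩ := exists_swap w (p := 1) (by decide) a₀ S₁
    (fun u hu => ⟨(a2 u (hS₁ hu)).1, (a2 u (hS₁ hu)).2.1, l1 u (hS₁ hu)⟩) (a3.subset (by simpa))
  obtain ⟨a₂, q1, q2, q3, q4⟩ := exists_swap w (p := 2) (by decide) a₁ S₂
    (fun u hu => ⟨(b2 u (hS₂ hu)).1, (b2 u (hS₂ hu)).2.1, by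
      rw [p1 _ (hsub4 hS₁ (Finset.disjoint_right.1 e12 (hmem (hS₂ hu)).1)),
        p1 _ (hsub4 hS₁ (Finset.disjoint_right.1 e12 (hmem (hS₂ hu)).2))]
      exact l2 u (hS₂ hu)⟩) (b3.subset (by simpa))
  obtain ⟨a₃, r1, r2, r3, r4⟩ := exists_swap w (p := 3) (by decide) a₂ S₃
    (fun u hu => ⟨(c2 u (hS₃ hu)).1, (c2 u (hS₃ hu)).2.1, by
      rw [q1 _ (hsub4 hS₂ (Finset.disjoint_left.1 c4.2 (hmem (hS₃ hu)).1)),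
        q1 _ (hsub4 hS₂ (Finset.disjoint_left.1 c4.2 (hmem (hS₃ hu)).2)),
        p1 _ (hsub4 hS₁ (Finset.disjoint_left.1 c4.1 (hmem (hS₃ hu)).1)),
        p1 _ (hsub4 hS₁ (Finset.disjoint_left.1 c4.1 (hmem (hS₃ hu)).2))]
      exact l3 u (hS₃ hu)⟩) (c3.subset (by simpa))
  have w1 : wt w (4 * n) a₃ 1 = t 1 := by
    rw [r3 1 (by decide) (by decide), q3 1 (by decide) (by decide), p2, hs1]; ring
  have w2 : wt w (4 * n) a₃ 2 = t 2 := by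
    rw [r3 2 (by decide) (by decide), q2, p3 2 (by decide) (by decide), hs2]; ring
  have w3 : wt w (4 * n) a₃ 3 = t 3 := by
    rw [r2, q3 3 (by decide) (by decide), p3 3 (by decide) (by decide), hs3]; ring
  have w0 : wt w (4 * n) a₃ 0 = t 0 := by
    have h1 := sum_wt w (4 * n) a₃
    rw [hwsum, Fin.sum_univ_four, w1, w2, w3] at h1
    have h2 : ((∑ p, t p : ℕ) : ℤ) = n := by rw [ht]
    rw [Fin.sum_univ_four] at h2
    push_cast at h2
    linarith
  have hall : ∀ p, wt w (4 * n) a₃ p = t p := by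
    intro p
    fin_cases p
    exacts [w0, w1, w2, w3]
  refine ⟨fun p i => cnt a₃ p (f i), fun p => ?_, fun i => ?_, fun p i => ?_⟩
  · refine IsPart.of (N := n) ?_ ?_ ?_
    · intro i j hij
      unfold cnt
      exact card_le_card (filter_subset_filter _ (by simpa using h.anti hij))
    · intro i hi
      simp [cnt, h.zero i hi]
    · have := sum_cnt_eq_wt (n := n) a₃ p hfn
      rw [← hw, hall p] at this
      exact_mod_cast this
  · have := card_eq_sum_card_fiberwise (f := a₃) (s := range (f i)) (t := univ) (by simp)
    rwa [card_range] at this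
  · have h1 := cnt_assign_le π p (f i)
    have h2 := p4 p (f i)
    have h3 := q4 p (f i)
    have h4 := r4 p (f i)
    have h5 := card_le_card hS₁
    have h6 := card_le_card hS₂
    have h7 := card_le_card hS₃
    dsimp only
    rw [← ha₀] at h1
    omega

end

/-! ### From splittings to dominance-comparable decompositions -/

section

open Finset Filter Topology

lemma exists_scales {θ : ℝ} (hθ : 0 < θ) : ∀ᶠ n : ℕ in atTop, ∃ L N Q R : ℕ,
    2.8 * √(n : ℝ) ≤ L ∧ 1 ≤ N ∧ 0 < Q ∧ 12 * (Q + N) ≤ R ∧ 8 * R < ⌈θ * √(n : ℝ)⌉₊ ∧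
    4 * R + (L / Q + 1) * N < ⌈θ * √(n : ℝ)⌉₊ ∧ 4 * (R : ℝ) + 8 ≤ 0.008 * √(n : ℝ) ∧
    3 * √(n : ℝ) + 2 + 3 * L ≤ 4 * ((N : ℝ) * N) := by
  obtain ⟨κ, hκ, hκθ, hκ1⟩ : ∃ κ : ℝ, 0 < κ ∧ 1000 * κ ≤ θ ∧ 10000 * κ ≤ 1 :=
    ⟨min (θ / 1000) (1 / 10000), by positivity,
      by linarith [min_le_left (θ / 1000) (1 / 10000)],
      by linarith [min_le_right (θ / 1000) (1 / 10000)]⟩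
  have htend : Tendsto (fun n : ℕ => √√(n : ℝ)) atTop atTop :=
    Real.tendsto_sqrt_atTop.comp (Real.tendsto_sqrt_atTop.comp tendsto_natCast_atTop_atTop)
  filter_upwards [htend.eventually_ge_atTop (10 ^ 6 / κ), htend.eventually_ge_atTop (1 / κ ^ 2)]
    with n h1 h2
  have hu2 : √√(n : ℝ) * √√(n : ℝ) = √(n : ℝ) := Real.mul_self_sqrt (Real.sqrt_nonneg _)
  set u := √√(n : ℝ)
  rw [← hu2]
  rw [div_le_iff₀ hκ] at h1
  rw [div_le_iff₀ (by positivity)] at h2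
  have hu : 10 ^ 10 ≤ u := by nlinarith
  have hκu : 10 ^ 6 * u ≤ κ * (u * u) := by nlinarith
  have hκu' : u ≤ κ ^ 2 * (u * u) := by nlinarith
  have huu : 10 ^ 10 * u ≤ u * u := by nlinarith
  have hθu : 1000 * (κ * (u * u)) ≤ θ * (u * u) := by nlinarith
  have hκuu : 10000 * (κ * (u * u)) ≤ u * u := by nlinarith
  set N := ⌈2 * u⌉₊
  set Q := ⌊κ * (u * u)⌋₊
  set L := ⌈2.8 * (u * u)⌉₊
  have hN1 : 2 * u ≤ N := Nat.le_ceil _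
  have hN2 : (N : ℝ) < 2 * u + 1 := Nat.ceil_lt_add_one (by positivity)
  have hQ1 : (Q : ℝ) ≤ κ * (u * u) := Nat.floor_le (by positivity)
  have hQ2 : κ * (u * u) < Q + 1 := Nat.lt_floor_add_one _
  have hL1 : 2.8 * (u * u) ≤ L := Nat.le_ceil _
  have hL2 : (L : ℝ) < 2.8 * (u * u) + 1 := Nat.ceil_lt_add_one (by positivity)
  have hQ0 : (0 : ℝ) < Q := by linarith
  have hLQ : ((L / Q : ℕ) : ℝ) ≤ 3 / κ := by
    refine Nat.cast_div_le.trans ?_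
    rw [div_le_div_iff₀ hQ0 hκ]
    nlinarith
  have hLQN : (((L / Q : ℕ) : ℝ) + 1) * N ≤ 12 * (κ * (u * u)) := by
    have h3 : ((L / Q : ℕ) : ℝ) + 1 ≤ 4 / κ := by
      have : 1 ≤ 1 / κ := by rw [le_div_iff₀ hκ]; linarith
      calc _ ≤ 3 / κ + 1 / κ := by linarith
        _ = 4 / κ := by ring
    calc _ ≤ 4 / κ * (3 * u) := by gcongr; linarith
      _ = 12 / κ * u := by ring
      _ ≤ 12 / κ * (κ ^ 2 * (u * u)) := by gcongr
      _ = _ := by field_simp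
  refine ⟨L, N, Q, 12 * (Q + N), hL1, ?_, by exact_mod_cast hQ0, le_rfl, ?_, ?_, ?_, ?_⟩
  · have : (0 : ℝ) < N := by linarith
    exact_mod_cast this
  · rw [Nat.lt_ceil]
    push_cast
    linarith
  · rw [Nat.lt_ceil]
    push_cast
    linarith
  · push_cast
    linarith
  · nlinarith

/-- The partial sums of a staircase. -/
lemma two_mul_sum_rho {k r : ℕ} (h : r ≤ k) :
    2 * ((∑ i ∈ range r, rho k i : ℕ) : ℤ) = 2 * r * k - r * (r - 1) := by
  induction r with
  | zero => simp
  | succ r ih =>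
    rw [sum_range_succ]
    have := ih (by omega)
    unfold rho at *
    push_cast [Nat.cast_sub (show r ≤ k by omega)] at *
    linarith

lemma two_mul_tri (k : ℕ) : 2 * tri k = k * (k + 1) :=
  Nat.mul_div_cancel' (Nat.even_mul_succ_self k).two_dvd

lemma tendsto_tri : Tendsto tri atTop atTop := tendsto_atTop_mono
  (fun m => by have := two_mul_tri m; dsimp only [id]; nlinarith [Nat.le_mul_self m]) tendsto_id

lemma IsPart.dominates_of_le {k : ℕ} {g : ℕ → ℕ} (h : IsPart (tri k) g)
    (hle : ∀ r ≤ k, ∑ i ∈ range r, g i ≤ ∑ i ∈ range r, rho k i) : Dominates (rho k) g := by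
  intro r
  rcases le_total r k with hr | hr
  · exact hle r hr
  · calc ∑ i ∈ range r, g i ≤ ∑ i ∈ range (max r (tri k)), g i :=
          sum_le_sum_of_subset (by simp)
      _ = tri k := h.sum_range (le_max_right _ _)
      _ = ∑ i ∈ range k, rho k i := by
          have h1 := two_mul_sum_rho (le_refl k)
          have h2 := two_mul_tri k
          zify at h2
          rw [← Nat.cast_inj (R := ℤ)]
          linarith
      _ ≤ ∑ i ∈ range r, rho k i := sum_le_sum_of_subset (by simpa)

/-- The indices of the four staircases. -/
def quarter (m : ℕ) : Fin 4 → ℕ := ![(m + 1) / 2, m / 2, m / 2, (m - 1) / 2]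

lemma sum_tri_quarter {m : ℕ} (hm : 1 ≤ m) : ∑ p, tri (quarter m p) = tri m := by
  have h1 := two_mul_tri ((m + 1) / 2)
  have h2 := two_mul_tri (m / 2)
  have h3 := two_mul_tri ((m - 1) / 2)
  have h4 := two_mul_tri m
  simp only [Fin.sum_univ_four, quarter, Matrix.cons_val]
  obtain ⟨k, rfl | rfl⟩ : ∃ k, m = 2 * k + 1 ∨ m = 2 * k + 2 := ⟨(m - 1) / 2, by omega⟩
  · rw [show (2 * k + 1 + 1) / 2 = k + 1 by omega, show (2 * k + 1) / 2 = k by omega,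
      show (2 * k + 1 - 1) / 2 = k by omega] at *
    nlinarith
  · rw [show (2 * k + 2 + 1) / 2 = k + 1 by omega, show (2 * k + 2) / 2 = k + 1 by omega,
      show (2 * k + 2 - 1) / 2 = k by omega] at *
    nlinarith

lemma quarter_bounds (m : ℕ) (p : Fin 4) : m ≤ 2 * quarter m p + 2 ∧ 2 * quarter m p ≤ m + 1 := by
  fin_cases p <;> simp [quarter] <;> omega

lemma abs_four_mul_tri_quarter_sub_le (m : ℕ) (p : Fin 4) :
    |4 * (tri (quarter m p) : ℤ) - tri m| ≤ 2 * m + 2 := by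
  obtain ⟨h1, h2⟩ := quarter_bounds m p
  have h3 := two_mul_tri (quarter m p)
  have h4 := two_mul_tri m
  set k := quarter m p
  obtain ⟨e, he, he'⟩ : ∃ e : ℤ, (m : ℤ) = 2 * k + e ∧ -1 ≤ e ∧ e ≤ 2 := ⟨m - 2 * k, by omega⟩
  zify at h3 h4
  rw [abs_le]
  obtain ⟨h5, h6⟩ := he'
  constructor <;> interval_cases e <;> nlinarith

lemma goodDecomp_of_forall {m : ℕ} {f : ℕ → ℕ} {g : Fin 4 → ℕ → ℕ}
    (hg : ∀ p, IsPart (tri (quarter m p)) (g p)) (hf : ∀ i, f i = ∑ p, g p i)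
    (hd : ∀ p, DomComparable (g p) (rho (quarter m p))) : GoodDecomp m f := by
  have h := fun p => isPart_iff.1 (hg p)
  refine ⟨g 0, g 1, g 2, g 3, (h 0).1, (h 1).1, (h 2).1, (h 3).1, (h 0).2, (h 1).2, (h 2).2,
    (h 3).2, hd 0, hd 1, hd 2, hd 3, ?_⟩
  funext i
  rw [hf i, Fin.sum_univ_four]
  rfl

/-- The deterministic part of the theorem. -/
theorem eventually_goodDecomp (B : ℕ) {θ : ℝ} (hθ : 0 < θ) : ∀ᶠ m : ℕ in atTop,
    ∀ f, IsPart (tri m) f → (∀ i : ℕ, 2.8 * √(tri m : ℝ) ≤ i → f i = 0) →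
      ¬ Poor B ⌈θ * √(tri m : ℝ)⌉₊ (cor f) →
      (∀ r : ℕ, 1 ≤ r → r ≤ 0.71 * √(tri m : ℝ) →
        ((∑ i ∈ range r, f i : ℕ) : ℝ) ≤ r * (2.82 * √(tri m : ℝ) - 2 * r)) →
      GoodDecomp m f := by
  filter_upwards [tendsto_tri.eventually (exists_scales hθ), eventually_ge_atTop 1000] with m hsc hm
  intro f hf hlen hpoor hrows
  obtain ⟨L, N, Q, R, hL, hN, hQ, hR, hRθ, hLQ, hRs, hN2⟩ := hsc
  have hs := Real.sq_sqrt (Nat.cast_nonneg (α := ℝ) (tri m))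
  have hs0 := Real.sqrt_nonneg (tri m : ℝ)
  have htm := two_mul_tri m
  have htm' : 2 * (tri m : ℝ) = m * (m + 1) := by exact_mod_cast htm
  set s := √(tri m : ℝ) with hsdef
  have hm' : (1000 : ℝ) ≤ m := by exact_mod_cast hm
  have hms : (m : ℝ) ≤ 1.4143 * s := by nlinarith
  have hsm : 1.4142 * s ≤ m + 1 := by nlinarith
  obtain ⟨δ, -, hδ', hδ⟩ : ∃ δ < B, (δ = 0 ∨ ⌈θ * s⌉₊ ≤ prs (cor f) δ) ∧
      ⌈θ * s⌉₊ ≤ prs (cor f) (δ + 1) := by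
    unfold Poor at hpoor
    push Not at hpoor
    exact hpoor
  have hcard : prs (cor f) (δ + 1) ≤ #(cor f) := card_filter_le _ _
  obtain ⟨g, hg, hfg, hgle⟩ := hf.exists_split (L := L) (N := N) (Q := Q) (R := R) (δ := δ) hN hQ
    (fun i hi => hlen i (hL.trans (by exact_mod_cast hi))) (by omega)
    (hδ'.imp_right fun h => by omega) (by omega) hR (fun p => tri (quarter m p))
    (sum_tri_quarter (by omega)) (by
      intro p
      have h1 := abs_four_mul_tri_quarter_sub_le m p
      have h2 : (2 * m + 2 + 3 * L : ℝ) ≤ 4 * (N * N) := by linarith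
      have h3 : (2 * m + 2 + 3 * L : ℤ) ≤ 4 * (N * N) := by exact_mod_cast h2
      linarith)
  refine goodDecomp_of_forall hg hfg fun p => Or.inr ((hg p).dominates_of_le fun r hr => ?_)
  obtain ⟨h1, h2⟩ := quarter_bounds m p
  rcases Nat.eq_zero_or_pos r with rfl | hr0
  · simp
  have hr0' : (1 : ℝ) ≤ r := by exact_mod_cast hr0
  have hrk : (r : ℝ) ≤ quarter m p := by exact_mod_cast hr
  have h1' : (m : ℝ) ≤ 2 * quarter m p + 2 := by exact_mod_cast h1
  have h2' : 2 * (quarter m p : ℝ) ≤ m + 1 := by exact_mod_cast h2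
  have h3 := hrows r hr0 (by linarith)
  have h4 : 4 * ∑ i ∈ range r, g p i ≤ ∑ i ∈ range r, f i + r * (4 * (R + 1)) := by
    rw [mul_sum]
    refine (sum_le_sum fun i _ => hgle p i).trans_eq ?_
    rw [sum_add_distrib, sum_const, card_range, smul_eq_mul]
  have h4' : 4 * ((∑ i ∈ range r, g p i : ℕ) : ℝ) ≤ ((∑ i ∈ range r, f i : ℕ) : ℝ)
      + r * (4 * (R + 1)) := by exact_mod_cast h4
  have h5 : 2 * ((∑ i ∈ range r, rho (quarter m p) i : ℕ) : ℝ)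
      = 2 * r * quarter m p - r * (r - 1) := by exact_mod_cast two_mul_sum_rho hr
  have h6 : (r : ℝ) * (2.82 * s + 4 * R + 4) ≤ r * (4 * quarter m p + 2) :=
    mul_le_mul_of_nonneg_left (by linarith) (by linarith)
  rw [← Nat.cast_le (α := ℝ)]
  nlinarith

end

/-! ### The limit -/

section

open Finset Filter Topology

lemma tendsto_pr_goodDecomp : Tendsto (fun m => pr (tri m) (GoodDecomp m)) atTop (𝓝 1) := by
  rw [tendsto_order]
  refine ⟨fun a ha => ?_, fun a ha => Eventually.of_forall fun m => (pr_le_one _ _).trans_lt ha⟩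
  obtain ⟨ε, hε, hεa⟩ : ∃ ε : ℝ, 0 < ε ∧ a = 1 - 4 * ε := ⟨(1 - a) / 4, by linarith, by ring⟩
  obtain ⟨B, -, θ, hθ, hpoor⟩ := exists_eventually_pr_poor_le (ε := ε / 2) (by linarith)
  filter_upwards [eventually_goodDecomp B hθ, tendsto_tri.eventually hpoor,
    tendsto_tri.eventually (tendsto_pr_length.eventually_lt_const hε),
    tendsto_tri.eventually (tendsto_pr_rows.eventually_lt_const hε),
    tendsto_tri.eventually (tendsto_pr_twoContent.eventually_lt_const hε),
    tendsto_tri.eventually_ge_atTop 10000] with m hgood h1 h2 h3 h4 hn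
  have hcover := one_sub_pr_not_le (tri m) (GoodDecomp m)
  have hbad : pr (tri m) (fun f => ¬ GoodDecomp m f) ≤ pr (tri m) (fun f =>
      (Poor B ⌈θ * √(tri m : ℝ)⌉₊ (cor f) ∨ ∃ i : ℕ, 2.8 * √(tri m : ℝ) ≤ i ∧ f i ≠ 0) ∨
      ((∃ r : ℕ, 1 ≤ r ∧ r ≤ 0.27 * √(tri m : ℝ) ∧
        r * (2.82 * √(tri m : ℝ) - 2 * r) < (∑ i ∈ range r, f i : ℕ)) ∨
      tri m * √(tri m : ℝ) / 50 < twoContent f)) := by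
    refine pr_mono fun f hf hnot => ?_
    by_contra hcon
    push Not at hcon
    obtain ⟨⟨c1, c2⟩, c3, c4⟩ := hcon
    refine hnot (hgood f hf c2 c1 fun r hr0 hr => ?_)
    rcases le_total (r : ℝ) (0.27 * √(tri m : ℝ)) with h | h
    · exact c3 r hr0 h
    · exact rows_middle hf hn c2 c4 h hr
  have h5 := hbad.trans ((pr_or_le _ _).trans (add_le_add (pr_or_le _ _) (pr_or_le _ _)))
  linarith

/-- The Plancherel probability of an event, as a sum over a subtype. -/
lemma tsum_sytCount_sq_div_eq_pr (n : ℕ) (P : (ℕ → ℕ) → Prop) :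
    (∑' f : {f : ℕ → ℕ // IsPtnFun f ∧ psize f = n ∧ P f}, (sytCount f.1 : ℝ) ^ 2)
      / (n.factorial : ℝ) = pr n P := by
  classical
  rw [pr_eq]
  congr 1
  have h : {f : ℕ → ℕ | IsPtnFun f ∧ psize f = n ∧ P f} = ↑{f ∈ ptns n | P f} := by
    ext f
    simp [mem_ptns, isPart_iff, and_assoc]
  rw [← Finset.tsum_subtype' {f ∈ ptns n | P f} (fun f => dimR f ^ 2), ← h]
  rfl

end

end Plancherel

/-- Under the Plancherel measure (which gives `λ ⊢ n` probability `(f^λ)²/n!`) on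
partitions of `n = T_m`, the probability that a random partition admits a good
staircase decomposition tends to `1` as `m → ∞`. -/
theorem plancherel_good_decomposition :
    Filter.Tendsto
      (fun m : ℕ =>
        (∑' lam : {f : ℕ → ℕ // IsPtnFun f ∧ psize f = tri m ∧ GoodDecomp m f},
            ((sytCount lam.1 : ℝ)) ^ 2) / ((tri m).factorial : ℝ))
      Filter.atTop (nhds 1) := by
  simp only [Plancherel.tsum_sytCount_sq_div_eq_pr]
  exact Plancherel.tendsto_pr_goodDecomp
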